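/- arXiv:1607.01117 — 5 statements merged into one kernel-verified Lean document; each statement's English description precedes it below -/
import Mathlib

section
/- Let c, d, h be positive integers with d^c ≤ (d/c)^h (i.e. d^c · c^h ≤ d^h). Then the complete d-ary tree of height h has no anagram-free vertex colouring using at most c colours. -/
/-- A word is an *anagram* if it has the form `w₁ ++ w₂` where `w₁` is non-empty
and `w₂` is a permutation of `w₁`. -/
def IsAnagram {α : Type*} (l : List α) : Prop :=
  ∃ w₁ w₂ : List α, w₁ ≠ [] ∧ List.Perm w₁ w₂ ∧ l = w₁ ++ w₂

/-- A word is a *`k`-anagram* if it is a concatenation of `k` permutations of a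
fixed non-empty word `W`. -/
def IsKAnagram {α : Type*} (k : ℕ) (l : List α) : Prop :=
  ∃ (W : List α) (ws : List (List α)), W ≠ [] ∧ ws.length = k ∧
    (∀ w ∈ ws, List.Perm w W) ∧ l = ws.flatten

/-- A vertex colouring `f` of a graph `G` is *anagram-free* if the colour
sequence on the vertices of every path of `G` is not an anagram. -/
def AnagramFreeVC {V C : Type*} (G : SimpleGraph V) (f : V → C) : Prop :=
  ∀ ⦃u v : V⦄ (p : G.Walk u v), p.IsPath → ¬ IsAnagram (p.support.map f)

/-- An edge colouring `f` of a graph `G` is *anagram-free* if the colour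
sequence on the edges of every path of `G` is not an anagram. -/
def AnagramFreeEC {V C : Type*} (G : SimpleGraph V) (f : Sym2 V → C) : Prop :=
  ∀ ⦃u v : V⦄ (p : G.Walk u v), p.IsPath → ¬ IsAnagram (p.edges.map f)

/-- A vertex colouring `f` of a graph `G` is *`k`-anagram-free* if the colour
sequence on the vertices of every path of `G` is not a `k`-anagram. -/
def KAnagramFreeVC {V C : Type*} (k : ℕ) (G : SimpleGraph V) (f : V → C) : Prop :=
  ∀ ⦃u v : V⦄ (p : G.Walk u v), p.IsPath → ¬ IsKAnagram k (p.support.map f)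

/-- An edge colouring `f` of a graph `G` is *`k`-anagram-free* if the colour
sequence on the edges of every path of `G` is not a `k`-anagram. -/
def KAnagramFreeEC {V C : Type*} (k : ℕ) (G : SimpleGraph V) (f : Sym2 V → C) : Prop :=
  ∀ ⦃u v : V⦄ (p : G.Walk u v), p.IsPath → ¬ IsKAnagram k (p.edges.map f)

/-- The vertex set of the complete `d`-ary tree of height `h`: sequences of
branching choices of length at most `h` (the root is the empty list and the
leaves are the lists of length exactly `h`). -/
abbrev daryVertex (d h : ℕ) : Type := {l : List (Fin d) // l.length ≤ h}

/-- The complete `d`-ary tree of height `h`: every internal vertex has `d`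
children and every leaf is at distance `h` from the root. -/
def daryTree (d h : ℕ) : SimpleGraph (daryVertex d h) :=
  SimpleGraph.fromRel (fun x y => ∃ a : Fin d, y.1 = a :: x.1)

/-- `HasPathDecomp G w` means `G` has a path decomposition of width at most `w`:
a sequence of bags covering all vertices and edges, where the bags containing a
fixed vertex form a contiguous interval and each bag has at most `w + 1`
vertices.  Thus `HasPathDecomp G w` says that the pathwidth of `G` is at
most `w`. -/
def HasPathDecomp {V : Type*} (G : SimpleGraph V) (w : ℕ) : Prop :=
  ∃ (n : ℕ) (B : Fin n → Finset V),
    (∀ v : V, ∃ i, v ∈ B i) ∧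
    (∀ ⦃u v : V⦄, G.Adj u v → ∃ i, u ∈ B i ∧ v ∈ B i) ∧
    (∀ (v : V) (i j k : Fin n), i ≤ j → j ≤ k → v ∈ B i → v ∈ B k → v ∈ B j) ∧
    (∀ i, (B i).card ≤ w + 1)

/-- adjacency on raw lists -/
def tAdj {d : ℕ} (x y : List (Fin d)) : Prop := (∃ a : Fin d, y = a :: x) ∨ ∃ a : Fin d, x = a :: y

theorem tAdj_symm {d : ℕ} {x y : List (Fin d)} (H : tAdj x y) : tAdj y x := H.symm

theorem exists_walk_of_chain {V : Type*} (G : SimpleGraph V) :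
    ∀ (l : List V) (u : V), List.IsChain G.Adj (u :: l) →
      ∃ (v : V) (p : G.Walk u v), p.support = u :: l
  | [], u, _ => ⟨u, SimpleGraph.Walk.nil, rfl⟩
  | w :: l, u, H => by
    rw [List.isChain_cons_cons] at H
    obtain ⟨v, p, hp⟩ := exists_walk_of_chain G l w H.2
    exact ⟨v, SimpleGraph.Walk.cons H.1 p, by simp [hp]⟩

/-- The colouring extended to all lists. -/
def extCol {c d h : ℕ} (f : daryVertex d h → Fin c) (l : List (Fin d)) : Fin c :=
  if H : l.length ≤ h then f ⟨l, H⟩ else f ⟨[], Nat.zero_le _⟩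

theorem af_lists {c d h : ℕ} {f : daryVertex d h → Fin c}
    (hf : AnagramFreeVC (daryTree d h) f) (l : List (List (Fin d)))
    (h1 : l.IsChain tAdj) (h2 : l.Nodup) (h3 : ∀ x ∈ l, x.length ≤ h) :
    ¬ IsAnagram (l.map (extCol f)) := by
  obtain ⟨m, rfl⟩ : ∃ m : List (daryVertex d h), m.map Subtype.val = l := by
    refine ⟨l.pmap (fun x hx => ⟨x, hx⟩) h3, ?_⟩
    simp [List.map_pmap]
  have hcol : (m.map Subtype.val).map (extCol f) = m.map f := by
    rw [List.map_map]
    apply List.map_congr_left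
    intro x _
    simp [extCol, x.2]
  rw [hcol]
  cases m with
  | nil =>
    rintro ⟨w1, w2, hne, _, he⟩
    simp at he
    exact hne he.1
  | cons u m =>
    have hn : (u :: m).Nodup := List.Nodup.of_map _ h2
    have hch : (u :: m).IsChain (daryTree d h).Adj := by
      rw [List.isChain_map] at h1
      refine h1.imp ?_
      intro x y hxy
      rw [daryTree, SimpleGraph.fromRel_adj]
      refine ⟨?_, hxy⟩
      rintro rfl
      rcases hxy with ⟨a, ha⟩ | ⟨a, ha⟩ <;> simpa using congrArg List.length ha
    obtain ⟨v, p, hp⟩ := exists_walk_of_chain _ m u hch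
    rw [← hp]
    exact hf p ((SimpleGraph.Walk.isPath_def p).2 (hp ▸ hn))

/-- vertices visited from `v` downwards following the choices `t`. -/
def chainL {d : ℕ} : List (Fin d) → List (Fin d) → List (List (Fin d))
  | v, [] => [v]
  | v, a :: t => v :: chainL (a :: v) t

theorem chainL_suffix {d : ℕ} : ∀ (t v x : List (Fin d)), x ∈ chainL v t → v <:+ x
  | [], v, x, hx => by simp [chainL] at hx; simp [hx]
  | a :: t, v, x, hx => by
    simp only [chainL, List.mem_cons] at hx
    rcases hx with rfl | hx
    · exact List.suffix_rfl
    · exact (List.suffix_cons a v).trans (chainL_suffix t _ x hx)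

theorem chainL_length {d : ℕ} :
    ∀ (t v x : List (Fin d)), x ∈ chainL v t → x.length ≤ v.length + t.length
  | [], v, x, hx => by simp [chainL] at hx; simp [hx]
  | a :: t, v, x, hx => by
    simp only [chainL, List.mem_cons] at hx
    rcases hx with rfl | hx
    · simp
    · have := chainL_length t _ x hx
      simp at this ⊢
      omega

theorem not_mem_chainL {d : ℕ} (a : Fin d) (v t : List (Fin d)) : v ∉ chainL (a :: v) t := by
  intro H
  have := (chainL_suffix t _ _ H).length_le
  simp at this

theorem chainL_nodup {d : ℕ} : ∀ (t v : List (Fin d)), (chainL v t).Nodup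
  | [], v => by simp [chainL]
  | a :: t, v => by
    simp only [chainL, List.nodup_cons]
    exact ⟨not_mem_chainL a v t, chainL_nodup t _⟩

theorem chainL_head {d : ℕ} (t v : List (Fin d)) : ∃ r, chainL v t = v :: r := by
  cases t <;> simp [chainL]

theorem chainL_chain {d : ℕ} : ∀ (t v : List (Fin d)), (chainL v t).IsChain tAdj
  | [], v => by simp [chainL]
  | a :: t, v => by
    have ih := chainL_chain t (a :: v)
    simp only [chainL]
    obtain ⟨r, hr⟩ := chainL_head t (a :: v)
    rw [hr] at ih ⊢
    exact List.isChain_cons_cons.2 ⟨Or.inl ⟨a, rfl⟩, ih⟩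

theorem branch {c d h : ℕ} {f : daryVertex d h → Fin c}
    (hf : AnagramFreeVC (daryTree d h) f) (v t s : List (Fin d)) (a b : Fin d) (hab : a ≠ b)
    (ht : v.length + 1 + t.length ≤ h) (hs : v.length + 1 + s.length ≤ h)
    (hw : (chainL (a :: v) t).map (extCol f) = (chainL (b :: v) s).map (extCol f)) :
    extCol f v ∉ (chainL (a :: v) t).map (extCol f) := by
  intro hmem
  obtain ⟨x, hx, hxv⟩ := List.mem_map.1 hmem
  obtain ⟨L1, L2, hL⟩ := List.append_of_mem hx
  have hw' := hw
  rw [hL, List.map_append] at hw'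
  obtain ⟨M1, M2, hM, hM1, -⟩ := List.map_eq_append_iff.1 hw'.symm
  have hdisj : ∀ y, y ∈ chainL (a :: v) t → y ∈ chainL (b :: v) s → False := by
    intro y h1 h2
    have e := (List.suffix_of_suffix_length_le (chainL_suffix _ _ _ h1)
      (chainL_suffix _ _ _ h2) (by simp)).eq_of_length (by simp)
    exact hab (List.cons.inj e).1
  have n1 := chainL_nodup (a :: t) v
  have n2 := chainL_nodup (b :: s) v
  have c1 := chainL_chain (a :: t) v
  have c2 := chainL_chain (b :: s) v
  have l1 := chainL_length t (a :: v)
  have l2 := chainL_length s (b :: v)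
  simp only [chainL] at n1 n2 c1 c2
  rw [hL] at n1 c1 l1 hdisj
  rw [hM] at n2 c2 l2 hdisj
  have c1' : ((L1 ++ [x]).reverse ++ [v]).IsChain tAdj := by
    have : (v :: (L1 ++ [x])).IsChain tAdj := by
      refine List.IsChain.prefix c1 ⟨L2, by simp⟩
    have h' := List.isChain_reverse.2 (this.imp (fun _ _ => tAdj_symm))
    simpa using h'
  have c2' : ([v] ++ M1).IsChain tAdj := List.IsChain.prefix c2 ⟨M2, by simp⟩
  refine af_lists hf ((L1 ++ [x]).reverse ++ [v] ++ M1) ?_ ?_ ?_ ?_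
  · exact List.IsChain.append_overlap c1' c2' (by simp)
  · simp only [List.nodup_cons, List.nodup_append, List.mem_append, List.mem_cons] at n1 n2
    simp only [List.mem_append, List.mem_cons] at hdisj
    simp [List.nodup_append]
    grind
  · intro y hy
    simp only [List.length_cons, List.mem_append, List.mem_cons] at l1 l2
    simp at hy
    rcases hy with rfl | hy | rfl | hy
    · have := l1 y (by simp); omega
    · have := l1 y (by simp [hy]); omega
    · omega
    · have := l2 y (by simp [hy]); omega
  · refine ⟨((L1 ++ [x]).reverse).map (extCol f), ([v] ++ M1).map (extCol f), by simp, ?_, by simp⟩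
    simp [hM1, hxv, List.reverse_perm]

theorem count {c d h : ℕ} {f : daryVertex d h → Fin c} (hd : 0 < d)
    (hf : AnagramFreeVC (daryTree d h) f) :
    ∀ (n : ℕ) (v : List (Fin d)) (W : List (Fin c)) (S : Finset (List (Fin d))),
      v.length + n ≤ h →
      (∀ t ∈ S, t.length = n ∧ (chainL v t).map (extCol f) = W) →
      S.card * d ≤ d ^ W.toFinset.card ∨ S = ∅
  | 0, v, W, S, _, hS => by
    rcases S.eq_empty_or_nonempty with h0 | ⟨t, ht⟩
    · exact Or.inr h0
    left
    have hsub : S ⊆ {[]} := by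
      intro t ht
      simpa using (hS t ht).1
    have hc := Finset.card_le_card hsub
    have h1 := hS t ht
    have : t = [] := by simpa using h1.1
    subst this
    rw [← h1.2]
    simp [chainL] at hc ⊢
    nlinarith
  | n + 1, v, W, S, hv, hS => by
    classical
    rcases S.eq_empty_or_nonempty with h0 | ⟨t, ht⟩
    · exact Or.inr h0
    left
    obtain ⟨htl, htW⟩ := hS t ht
    obtain ⟨a, t, rfl⟩ : ∃ a t', t = a :: t' := List.exists_cons_of_length_eq_add_one htl
    simp only [chainL, List.map_cons] at htW
    subst htW
    set W' := (chainL (a :: v) t).map (extCol f) with hW'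
    let Sb : Fin d → Finset (List (Fin d)) := fun b =>
      S.preimage (List.cons b) (List.cons_injective.injOn)
    have key : ∀ b, (Sb b).card * d ≤ d ^ W'.toFinset.card := by
      intro b
      rcases count hd hf n (b :: v) W' (Sb b) (by simp; omega) (by
        intro s hs
        have := hS (b :: s) (by simpa [Sb] using hs)
        simpa [chainL] using this) with H | H
      · exact H
      · simp [H]
    have hcover : S ⊆ Finset.univ.biUnion (fun b => (Sb b).image (List.cons b)) := by
      intro s hs
      obtain ⟨b, s, rfl⟩ : ∃ a t', s = a :: t' :=
        List.exists_cons_of_length_eq_add_one (hS s hs).1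
      simp [Sb, hs]
    by_cases hbr : ∃ b s, b ≠ a ∧ b :: s ∈ S
    · obtain ⟨b, s, hba, hs⟩ := hbr
      have hs' := hS _ hs
      simp only [chainL, List.map_cons, List.length_cons, List.cons.injEq, true_and] at hs'
      have hnot : extCol f v ∉ W' := by
        refine branch hf v t s a b hba.symm ?_ ?_ hs'.2.symm
        · simp at htl; omega
        · omega
      have hcard : (extCol f v :: W').toFinset.card = W'.toFinset.card + 1 := by
        rw [List.toFinset_cons, Finset.card_insert_of_notMem (by simpa using hnot)]
      rw [hcard, pow_succ]
      have : S.card ≤ ∑ b, (Sb b).card :=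
        (Finset.card_le_card hcover).trans (Finset.card_biUnion_le.trans
          (Finset.sum_le_sum fun b _ => Finset.card_image_le))
      calc S.card * d ≤ (∑ b, (Sb b).card) * d := Nat.mul_le_mul_right _ this
        _ = ∑ b, (Sb b).card * d := Finset.sum_mul ..
        _ ≤ ∑ _b : Fin d, d ^ W'.toFinset.card := Finset.sum_le_sum fun b _ => key b
        _ = _ := by simp [mul_comm]
    · push Not at hbr
      have hsub : S ⊆ (Sb a).image (List.cons a) := by
        intro s hs
        obtain ⟨b, s, rfl⟩ : ∃ a t', s = a :: t' :=
          List.exists_cons_of_length_eq_add_one (hS s hs).1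
        by_cases hb : b = a
        · subst hb; simp [Sb, hs]
        · exact absurd hs (hbr b s hb)
      have h1 : S.card ≤ (Sb a).card := (Finset.card_le_card hsub).trans Finset.card_image_le
      calc S.card * d ≤ (Sb a).card * d := Nat.mul_le_mul_right _ h1
        _ ≤ _ := key a
        _ ≤ _ := Nat.pow_le_pow_right hd (Finset.card_le_card (by simp [List.toFinset_cons]))

theorem chainL_len {d : ℕ} : ∀ (t v : List (Fin d)), (chainL v t).length = t.length + 1
  | [], v => by simp [chainL]
  | a :: t, v => by simp [chainL, chainL_len t]

/-- If `c, d, h` are positive integers with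
`d ^ c ≤ (d / c) ^ h`, i.e. `d ^ c * c ^ h ≤ d ^ h`, then the complete `d`-ary
tree of height `h` has no anagram-free vertex colouring with at most `c`
colours. -/
theorem daryTree_no_anagramFree_colouring (c d h : ℕ)
    (hc : 0 < c) (hd : 0 < d) (hh : 0 < h)
    (hineq : d ^ c * c ^ h ≤ d ^ h) :
    ∀ f : daryVertex d h → Fin c, ¬ AnagramFreeVC (daryTree d h) f := by
  intro f hf
  classical
  rcases Nat.lt_or_ge 1 d with hd1 | hd1
  · have : Nonempty (List.Vector (Fin c) h) := ⟨List.Vector.replicate h ⟨0, hc⟩⟩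
    let F : List.Vector (Fin d) h → List.Vector (Fin c) h := fun t =>
      ⟨((chainL [] t.1).map (extCol f)).tail, by simp [chainL_len, t.2]⟩
    obtain ⟨W, hW⟩ := Fintype.exists_le_card_fiber_of_mul_le_card F (n := d ^ c)
      (by simpa [card_vector, mul_comm] using hineq)
    let S : Finset (List (Fin d)) := (Finset.univ.filter fun t => F t = W).image List.Vector.toList
    have hS : d ^ c ≤ S.card := by
      rw [show S.card = _ from Finset.card_image_of_injective _ List.Vector.toList_injective]
      exact hW
    have hne : S ≠ ∅ := by
      rintro H
      rw [H] at hS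
      have : 0 < d ^ c := by positivity
      simp at hS
      omega
    rcases count hd hf h [] (extCol f [] :: W.1) S (by simp) (by
      intro t ht
      simp only [S, Finset.mem_image, Finset.mem_filter, Finset.mem_univ, true_and] at ht
      obtain ⟨t, ht, rfl⟩ := ht
      refine ⟨t.2, ?_⟩
      rw [← ht]
      obtain ⟨r, hr⟩ := chainL_head t.1 []
      change (chainL [] t.1).map (extCol f) = extCol f [] :: ((chainL [] t.1).map (extCol f)).tail
      simp [hr]) with H | H
    · have h2 : d ^ (extCol f [] :: W.1).toFinset.card ≤ d ^ c :=
        Nat.pow_le_pow_right hd (by simpa using Finset.card_le_univ (extCol f [] :: W.1).toFinset)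
      have : 0 < d ^ c := by positivity
      nlinarith
    · exact hne H
  · obtain rfl : d = 1 := by omega
    have hc1 : c = 1 := by
      by_contra hne
      have : 1 < c ^ h := Nat.one_lt_pow (by omega) (by omega)
      simp at hineq
      omega
    subst hc1
    refine af_lists hf [[], [0]] ?_ (by simp) (by simp; omega) ?_
    · simp [tAdj]
    · exact ⟨[extCol f []], [extCol f [0]], by simp, by
        rw [Subsingleton.elim (extCol f []) (extCol f [0])], by simp⟩
end

section
/- For every integer d' ≥ 1 there exists a tree T with maximum degree at most d' such that φ(T) ≥ d' − 1, i.e. every anagram-free vertex colouring of T uses at least d' − 1 colours. -/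
namespace AnagramTree

/-- Adjacency in the infinite binary tree on words. -/
def Rel (x y : List Bool) : Prop := (∃ a, x = a :: y) ∨ (∃ a, y = a :: x)

/-- weight: number of proper suffixes satisfying `P`. -/
def wt (P : List Bool → Prop) [DecidablePred P] : List Bool → ℕ
  | [] => 0
  | _ :: s => wt P s + if P s then 1 else 0

/-- number of suffixes of colour `i`. -/
def cnt {c : ℕ} (F : List Bool → Fin c) (i : Fin c) : List Bool → ℕ
  | [] => if F [] = i then 1 else 0
  | a :: s => cnt F i s + if F (a :: s) = i then 1 else 0

/-- the upward path from `p ++ s` to `s`. -/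
def up (p s : List Bool) : List (List Bool) := p.tails.map (· ++ s)

theorem up_nil (s : List Bool) : up [] s = [s] := by simp [up]

theorem up_cons (a : Bool) (p s : List Bool) : up (a :: p) s = (a :: (p ++ s)) :: up p s := by
  simp [up]

theorem mem_up {p s x : List Bool} : x ∈ up p s ↔ ∃ p', p' <:+ p ∧ x = p' ++ s := by
  simp [up, eq_comm]

theorem up_head (p s : List Bool) : (up p s).head? = some (p ++ s) := by
  cases p <;> simp [up]

theorem up_last (p s : List Bool) : (up p s).getLast? = some s := by
  induction p with
  | nil => simp [up]
  | cons a p ih => rw [up_cons, List.getLast?_cons, ih]; rfl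

theorem up_chain (p s : List Bool) : (up p s).IsChain Rel := by
  induction p with
  | nil => simp [up]
  | cons a p ih =>
    rw [up_cons, List.isChain_cons]
    refine ⟨?_, ih⟩
    intro y hy
    rw [up_head] at hy
    simp only [Option.mem_def, Option.some.injEq] at hy
    subst hy
    exact Or.inl ⟨a, rfl⟩

theorem up_nodup (p s : List Bool) : (up p s).Nodup := by
  induction p with
  | nil => simp [up]
  | cons a p ih =>
    rw [up_cons, List.nodup_cons]
    refine ⟨?_, ih⟩
    rw [mem_up]
    rintro ⟨p', hp', h⟩
    have h1 := hp'.length_le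
    have h2 := congrArg List.length h
    simp at h2
    omega

theorem count_up {c : ℕ} (F : List Bool → Fin c) (j : Fin c) (p s : List Bool) :
    ((up p s).map F).count j + cnt F j s = cnt F j (p ++ s) + if F s = j then 1 else 0 := by
  induction p with
  | nil => simp [up, List.count_singleton]; omega
  | cons a p ih =>
    rw [up_cons, List.map_cons, List.count_cons, List.cons_append, cnt]
    simp only [beq_iff_eq]
    omega

theorem sum_wt (P : List Bool → Prop) [DecidablePred P] (t : ℕ) :
    ∀ V : Finset (List Bool), (∀ v ∈ V, v.length = t) →
    (∀ v₁ ∈ V, ∀ v₂ ∈ V, ∀ s, (true :: s) <:+ v₁ → (false :: s) <:+ v₂ → ¬ P s) →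
    ∑ v ∈ V, 2 ^ wt P v ≤ 2 ^ t := by
  induction t with
  | zero =>
    intro V hV _
    have : V ⊆ {[]} := by
      intro v hv
      simpa using hV v hv
    calc ∑ v ∈ V, 2 ^ wt P v ≤ ∑ v ∈ ({[]} : Finset (List Bool)), 2 ^ wt P v :=
          Finset.sum_le_sum_of_subset this
      _ ≤ 2 ^ 0 := by simp [wt]
  | succ t ih =>
    intro V hV hP
    have hcons : ∀ v ∈ V, ∃ a, v = a :: v.tail := by
      intro v hv
      have := hV v hv
      cases v with
      | nil => simp at this
      | cons a s => exact ⟨a, rfl⟩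
    have h1 := ih (V.image List.tail) (by
        intro v hv
        obtain ⟨x, hx, rfl⟩ := Finset.mem_image.1 hv
        simp [hV x hx]) (by
        intro v₁ h₁ v₂ h₂ s hs₁ hs₂
        obtain ⟨x, hx, rfl⟩ := Finset.mem_image.1 h₁
        obtain ⟨y, hy, rfl⟩ := Finset.mem_image.1 h₂
        exact hP x hx y hy s (hs₁.trans (List.tail_suffix x)) (hs₂.trans (List.tail_suffix y)))
    have h2 : ∀ p ∈ V.image List.tail,
        ∑ v ∈ V with v.tail = p, 2 ^ wt P v ≤ 2 * 2 ^ wt P p := by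
      intro p _
      have hsub : ∀ v ∈ V.filter (fun v => v.tail = p), v = true :: p ∨ v = false :: p := by
        intro v hv
        obtain ⟨hvV, rfl⟩ := Finset.mem_filter.1 hv
        obtain ⟨a, ha⟩ := hcons v hvV
        cases a
        · exact Or.inr ha
        · exact Or.inl ha
      by_cases hp : P p
      · have : ∃ b : Bool, V.filter (fun v => v.tail = p) ⊆ {b :: p} := by
          by_cases ht : true :: p ∈ V
          · refine ⟨true, fun v hv => ?_⟩
            rcases hsub v hv with h | h
            · simp [h]
            · subst h
              exact absurd hp (hP _ ht _ (Finset.mem_filter.1 hv).1 p (List.suffix_refl _)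
                (List.suffix_refl _))
          · refine ⟨false, fun v hv => ?_⟩
            rcases hsub v hv with h | h
            · subst h
              exact absurd (Finset.mem_filter.1 hv).1 ht
            · simp [h]
        obtain ⟨b, hb⟩ := this
        refine (Finset.sum_le_sum_of_subset hb).trans ?_
        simp [wt, hp, pow_succ, mul_comm]
      · have : V.filter (fun v => v.tail = p) ⊆ {true :: p, false :: p} := by
          intro v hv
          simpa using hsub v hv
        refine (Finset.sum_le_sum_of_subset this).trans ?_
        rw [Finset.sum_pair (by simp)]
        simp [wt, hp, two_mul]
    rw [← Finset.sum_fiberwise_of_maps_to (s := V) (t := V.image List.tail) (g := List.tail)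
      (fun v hv => Finset.mem_image_of_mem _ hv)]
    refine (Finset.sum_le_sum h2).trans ?_
    rw [← Finset.mul_sum, pow_succ]
    omega

theorem exists_suffix {c : ℕ} (F : List Bool → Fin c) (i : Fin c) (k : ℕ) (hk : 1 ≤ k)
    (l : List Bool) (h : k ≤ cnt F i l) : ∃ v, v <:+ l ∧ F v = i ∧ k ≤ cnt F i v := by
  induction l with
  | nil =>
    refine ⟨[], List.suffix_refl _, ?_, h⟩
    by_contra hne
    simp [cnt, hne] at h
    omega
  | cons a s ih =>
    by_cases hF : F (a :: s) = i
    · exact ⟨_, List.suffix_refl _, hF, h⟩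
    · simp [cnt, hF] at h
      obtain ⟨v, h1, h2⟩ := ih h
      exact ⟨v, h1.trans (List.suffix_cons a s), h2⟩

theorem sum_cnt {c : ℕ} (F : List Bool → Fin c) (l : List Bool) :
    ∑ i, cnt F i l = l.length + 1 := by
  induction l with
  | nil => simp [cnt]
  | cons a s ih => simp [cnt, Finset.sum_add_distrib, ih]

theorem cnt_le {c : ℕ} (F : List Bool → Fin c) (i : Fin c) (l : List Bool) :
    cnt F i l ≤ l.length + 1 := by
  rw [← sum_cnt F l]
  exact Finset.single_le_sum (f := fun i => cnt F i l) (fun _ _ => Nat.zero_le _)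
    (Finset.mem_univ i)

theorem wt_ge {c : ℕ} (F : List Bool → Fin c) (i : Fin c) (v l : List Bool) (hv : v <:+ l)
    (hF : F v = i) :
    cnt F i v ≤ wt (fun s => F s = i ∧ s.length < v.length) l + 1 := by
  have base : ∀ s : List Bool, s.length < v.length →
      cnt F i s ≤ wt (fun s => F s = i ∧ s.length < v.length) s + if F s = i then 1 else 0 := by
    intro s
    induction s with
    | nil => intro _; simp [cnt]
    | cons a s ih =>
      intro h
      have h' : s.length < v.length := by simp at h; omega
      have := ih h'
      simp only [cnt, wt, h', and_true]
      omega
  obtain ⟨r, rfl⟩ := hv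
  induction r with
  | nil =>
    cases v with
    | nil => simp [cnt]; split_ifs; all_goals omega
    | cons a s =>
      have := base s (by simp)
      simp only [List.nil_append, cnt, wt, hF, if_true]
      simp only [List.length_cons, Nat.lt_succ_self, and_true] at *
      omega
  | cons a r ih =>
    simp only [List.cons_append, wt]
    omega

theorem no_branch {c h : ℕ} (F : List Bool → Fin c)
    (H : ∀ L : List (List Bool), (∀ l ∈ L, l.length ≤ h) → L.IsChain Rel → L.Nodup →
      ¬ IsAnagram (L.map F))
    (v₁ v₂ s : List Bool) (h₁ : v₁.length ≤ h) (h₂ : v₂.length ≤ h)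
    (hF : F v₁ = F s) (hc : ∀ j, cnt F j v₁ = cnt F j v₂)
    (hs₁ : (true :: s) <:+ v₁) (hs₂ : (false :: s) <:+ v₂) : False := by
  obtain ⟨p₁, rfl⟩ := hs₁
  obtain ⟨q, rfl⟩ := hs₂
  obtain ⟨a, p, hp⟩ : ∃ a p, p₁ ++ [true] = a :: p := by
    cases p₁ with
    | nil => exact ⟨_, _, rfl⟩
    | cons a r => exact ⟨_, _, rfl⟩
  have hp' : p₁ ++ true :: s = a :: (p ++ s) := by
    rw [← List.cons_append, ← hp]; simp
  rw [hp'] at h₁ hF hc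
  have key : (up p s ++ (up q (false :: s)).reverse).map F =
      (up p s).map F ++ ((up q (false :: s)).map F).reverse := by simp
  refine H (up p s ++ (up q (false :: s)).reverse) ?_ ?_ ?_ ⟨_, _, ?_, ?_, key⟩
  · intro l hl
    rw [List.mem_append, List.mem_reverse, mem_up, mem_up] at hl
    rcases hl with ⟨r, hr, rfl⟩ | ⟨r, hr, rfl⟩
    · have := hr.length_le
      simp at h₁ ⊢; omega
    · have := hr.length_le
      simp at h₂ ⊢; omega
  · rw [List.isChain_append]
    refine ⟨up_chain _ _, ?_, ?_⟩
    · rw [List.isChain_reverse]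
      refine (up_chain _ _).imp ?_
      intro x y hxy
      exact hxy.symm
    · intro x hx y hy
      rw [up_last] at hx
      rw [List.head?_reverse, up_last] at hy
      simp only [Option.mem_def, Option.some.injEq] at hx hy
      subst hx hy
      exact Or.inr ⟨_, rfl⟩
  · rw [List.nodup_append']
    refine ⟨up_nodup _ _, List.nodup_reverse.2 (up_nodup _ _), ?_⟩
    intro x hx hy
    rw [List.mem_reverse, mem_up] at hy
    rw [mem_up] at hx
    obtain ⟨r, hr, rfl⟩ := hx
    obtain ⟨q', -, hq⟩ := hy
    have e : r = q' ++ [false] := by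
      apply List.append_cancel_right (bs := s)
      simpa using hq
    have : [false] <:+ p₁ ++ [true] := by
      rw [hp]
      exact ((List.suffix_append q' [false]).trans (e ▸ hr)).trans (List.suffix_cons _ _)
    obtain ⟨z, hz⟩ := this
    have := List.append_inj_right' hz rfl
    simp at this
  · cases p <;> simp [up]
  · rw [List.perm_iff_count]
    intro j
    have e1 := count_up F j p s
    have e2 := count_up F j q (false :: s)
    have e3 := hc j
    rw [List.count_reverse]
    simp only [cnt, hF] at e1 e2 e3
    omega

theorem main_count {c k n : ℕ} (F : List Bool → Fin c) (hk : 1 ≤ k) (hn : c * k ≤ n)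
    (hbig : ((n + 1) * c * (n + 2) ^ c) * 2 < 2 ^ k)
    (H : ∀ L : List (List Bool), (∀ l ∈ L, l.length ≤ n) → L.IsChain Rel → L.Nodup →
      ¬ IsAnagram (L.map F)) : False := by
  classical
  have ex : ∀ l : List.Vector Bool n, ∃ v, v <:+ l.1 ∧ k ≤ cnt F (F v) v := by
    intro l
    have : ∃ i, k ≤ cnt F i l.1 := by
      by_contra hcon
      push Not at hcon
      have h1 := sum_cnt F l.1
      have h2 : ∑ i, cnt F i l.1 ≤ ∑ _i : Fin c, k :=
        Finset.sum_le_sum (fun i _ => (hcon i).le)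
      simp at h2
      have := l.2
      omega
    obtain ⟨i, hi⟩ := this
    obtain ⟨v, a, b, d⟩ := exists_suffix F i k hk l.1 hi
    exact ⟨v, a, by rw [b]; exact d⟩
  choose v hv hkv using ex
  have hlen : ∀ l, (v l).length ≤ n := fun l => by
    have := (hv l).length_le
    rwa [l.2] at this
  let g : List.Vector Bool n → Fin (n + 1) × Fin c × (Fin c → Fin (n + 2)) := fun l =>
    (⟨(v l).length, by have := hlen l; omega⟩, F (v l), fun j => ⟨cnt F j (v l), by
      have := hlen l; have := cnt_le F j (v l); omega⟩)
  obtain ⟨y, -, hy⟩ := Finset.exists_lt_card_fiber_of_mul_lt_card_of_maps_to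
    (s := (Finset.univ : Finset (List.Vector Bool n))) (t := Finset.univ) (f := g)
    (n := 2 ^ n * 2 / 2 ^ k) (fun _ _ => Finset.mem_univ _) (by
      simp only [Finset.card_univ, Fintype.card_prod, Fintype.card_fin, Fintype.card_fun,
        card_vector, Fintype.card_bool]
      have hd := Nat.div_mul_le_self (2 ^ n * 2) (2 ^ k)
      set X := 2 ^ n * 2 / 2 ^ k
      have hpos : 0 < 2 ^ n := by positivity
      by_contra hcon
      push Not at hcon
      rw [← mul_assoc] at hcon
      set A := (n + 1) * c * (n + 2) ^ c
      have : 2 ^ n * 2 ^ k ≤ 2 ^ n * (A * 2) := by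
        calc 2 ^ n * 2 ^ k ≤ A * X * 2 ^ k := Nat.mul_le_mul_right _ hcon
          _ = A * (X * 2 ^ k) := by ring
          _ ≤ A * (2 ^ n * 2) := Nat.mul_le_mul_left _ hd
          _ = _ := by ring
      have := Nat.le_of_mul_le_mul_left this hpos
      omega)
  set S := Finset.univ.filter (fun l => g l = y) with hS
  have hgS : ∀ l ∈ S, (v l).length = y.1.1 ∧ F (v l) = y.2.1 ∧ ∀ j, cnt F j (v l) = (y.2.2 j).1 := by
    intro l hl
    have : g l = y := (Finset.mem_filter.1 hl).2
    rw [← this]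
    exact ⟨rfl, rfl, fun _ => rfl⟩
  have hsum := sum_wt (fun s => F s = y.2.1 ∧ s.length < y.1.1) n (S.image List.Vector.toList)
    (by
      intro w hw
      obtain ⟨l, _, rfl⟩ := Finset.mem_image.1 hw
      exact l.2)
    (by
      rintro w₁ hw₁ w₂ hw₂ s hs₁ hs₂ ⟨hPs, hls⟩
      obtain ⟨l₁, hl₁, rfl⟩ := Finset.mem_image.1 hw₁
      obtain ⟨l₂, hl₂, rfl⟩ := Finset.mem_image.1 hw₂
      obtain ⟨a1, a2, a3⟩ := hgS _ hl₁
      obtain ⟨b1, b2, b3⟩ := hgS _ hl₂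
      refine no_branch F H (v l₁) (v l₂) s (hlen _) (hlen _) (a2.trans hPs.symm)
        (fun j => (a3 j).trans (b3 j).symm) ?_ ?_
      · exact List.suffix_of_suffix_length_le hs₁ (hv l₁) (by simp; omega)
      · exact List.suffix_of_suffix_length_le hs₂ (hv l₂) (by simp; omega))
  rw [Finset.sum_image (fun a _ b _ h => List.Vector.eq _ _ h)] at hsum
  have hlow : S.card * 2 ^ (k - 1) ≤ 2 ^ n := by
    refine le_trans ?_ hsum
    rw [← smul_eq_mul]
    refine Finset.card_nsmul_le_sum _ _ _ ?_
    intro l hl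
    refine Nat.pow_le_pow_right (by norm_num) ?_
    obtain ⟨a1, a2, a3⟩ := hgS _ hl
    have := wt_ge F (F (v l)) (v l) l.toList (hv l) rfl
    have h2 := hkv l
    simp only [a1, a2] at this h2
    omega
  have hlow2 : S.card * 2 ^ k ≤ 2 ^ n * 2 := by
    obtain ⟨m, rfl⟩ : ∃ m, k = m + 1 := ⟨k - 1, by omega⟩
    simp at hlow
    rw [pow_succ]
    nlinarith
  have := (Nat.le_div_iff_mul_le (by positivity)).2 hlow2
  omega

theorem exists_big (C : ℕ) : ∃ k : ℕ, 1 ≤ k ∧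
    ((C * k + 1) * C * (C * k + 2) ^ C) * 2 < 2 ^ k := by
  have ht := tendsto_pow_const_div_const_pow_of_one_lt (C + 2) (r := (2 : ℝ)) (by norm_num)
  have hpos : (0 : ℝ) < 1 / (2 * (C + 2 : ℝ) ^ (C + 2)) := by positivity
  obtain ⟨k, hk, hk1⟩ := ((ht.eventually (gt_mem_nhds hpos)).and
    (Filter.eventually_ge_atTop 1)).exists
  refine ⟨k, hk1, ?_⟩
  rw [div_lt_div_iff₀ (by positivity) (by positivity)] at hk
  have hk' : k ^ (C + 2) * (2 * (C + 2) ^ (C + 2)) < 2 ^ k := by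
    have : ((k ^ (C + 2) * (2 * (C + 2) ^ (C + 2)) : ℕ) : ℝ) < ((2 ^ k : ℕ) : ℝ) := by
      push_cast
      linarith
    exact_mod_cast this
  refine lt_of_le_of_lt ?_ hk'
  have a1 : C * k + 1 ≤ (C + 2) * k := by nlinarith
  have a2 : C ≤ (C + 2) * k := by nlinarith
  have a3 : C * k + 2 ≤ (C + 2) * k := by nlinarith
  calc ((C * k + 1) * C * (C * k + 2) ^ C) * 2
      ≤ (((C + 2) * k) * ((C + 2) * k) * ((C + 2) * k) ^ C) * 2 := by gcongr
    _ = k ^ (C + 2) * (2 * (C + 2) ^ (C + 2)) := by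
      rw [mul_pow]; ring

/-- vertices of the binary tree of height `n`. -/
abbrev Vx (n : ℕ) : Type := {l : List Bool // l.length ≤ n}

/-- the complete binary tree. -/
def tree (n : ℕ) : SimpleGraph (Vx n) where
  Adj x y := Rel x.1 y.1
  symm := ⟨fun _ _ h => Or.symm h⟩
  loopless := ⟨fun x h => by
    rcases h with ⟨a, h⟩ | ⟨a, h⟩ <;>
    · have := congrArg List.length h
      simp at this⟩

instance finiteVx (n : ℕ) : Finite (Vx n) :=
  (List.finite_length_le Bool n).to_subtype

theorem tree_connected (n : ℕ) : (tree n).Connected := by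
  have h : ∀ (l : List Bool) (hl : l.length ≤ n), (tree n).Reachable ⟨l, hl⟩ ⟨[], by simp⟩ := by
    intro l
    induction l with
    | nil => intro _; exact SimpleGraph.Reachable.refl _
    | cons a s ih =>
      intro hl
      have hs : s.length ≤ n := by simp at hl; omega
      have : (tree n).Adj ⟨a :: s, hl⟩ ⟨s, hs⟩ := Or.inl ⟨a, rfl⟩
      exact this.reachable.trans (ih hs)
  have : Nonempty (Vx n) := ⟨⟨[], by simp⟩⟩
  exact ⟨fun x y => (h x.1 x.2).trans (h y.1 y.2).symm⟩

/-- the parent. -/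
def par {n : ℕ} (x : Vx n) : Vx n := ⟨x.1.tail, by have := x.2; simp; omega⟩

theorem tree_isTree (n : ℕ) : (tree n).IsTree := by
  rw [SimpleGraph.isTree_iff_connected_and_card]
  refine ⟨tree_connected n, le_antisymm ?_ (tree_connected n).card_vert_le_card_edgeSet_add_one⟩
  let r : Vx n := ⟨[], by simp⟩
  have hsub : (tree n).edgeSet ⊆ Set.image (fun x : Vx n => s(x, par x)) {r}ᶜ := by
    intro e
    induction e using Sym2.ind with
    | _ x y =>
      intro h
      rw [SimpleGraph.mem_edgeSet] at h
      rcases h with ⟨a, h⟩ | ⟨a, h⟩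
      · refine ⟨x, ?_, ?_⟩
        · intro hx
          have : x.1 = [] := congrArg Subtype.val hx
          simp [this] at h
        · have : par x = y := Subtype.ext (by simp [par, h])
          simp [this]
      · refine ⟨y, ?_, ?_⟩
        · intro hx
          have : y.1 = [] := congrArg Subtype.val hx
          simp [this] at h
        · have : par y = x := Subtype.ext (by simp [par, h])
          simp [this, Sym2.eq_swap]
  have h1 : (tree n).edgeSet.ncard ≤ ({r}ᶜ : Set (Vx n)).ncard :=
    (Set.ncard_le_ncard hsub (Set.toFinite _)).trans (Set.ncard_image_le (Set.toFinite _))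
  have h2 := Set.ncard_add_ncard_compl ({r} : Set (Vx n))
  rw [Set.ncard_singleton] at h2
  change (tree n).edgeSet.ncard + 1 ≤ _
  omega

theorem tree_degree (n : ℕ) (x : Vx n) : ((tree n).neighborSet x).ncard ≤ 3 := by
  have hinj : Set.InjOn (Subtype.val : Vx n → List Bool) ((tree n).neighborSet x) :=
    Subtype.val_injective.injOn
  rw [← hinj.ncard_image]
  have hsub : Set.image Subtype.val ((tree n).neighborSet x) ⊆
      (({x.1.tail, true :: x.1, false :: x.1} : Finset (List Bool)) : Set (List Bool)) := by
    rintro _ ⟨y, hy, rfl⟩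
    rcases hy with ⟨a, h⟩ | ⟨a, h⟩
    · simp [h]
    · cases a <;> simp [h]
  refine (Set.ncard_le_ncard hsub (Finset.finite_toSet _)).trans ?_
  rw [Set.ncard_coe_finset]
  exact Finset.card_le_three

theorem exists_walk {V : Type*} (G : SimpleGraph V) (x : V) (L : List V)
    (h : (x :: L).IsChain G.Adj) : ∃ (y : V) (p : G.Walk x y), p.support = x :: L := by
  induction L generalizing x with
  | nil => exact ⟨x, .nil, rfl⟩
  | cons b L ih =>
    rw [List.isChain_cons_cons] at h
    obtain ⟨y, p, hp⟩ := ih b h.2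
    exact ⟨y, .cons h.1 p, by simp [hp]⟩

theorem tree_not_free (C c : ℕ) (hc : c ≤ C) (k : ℕ) (hk : 1 ≤ k)
    (hbig : ((C * k + 1) * C * (C * k + 2) ^ C) * 2 < 2 ^ k)
    (f : Vx (C * k) → Fin c) : ¬ AnagramFreeVC (tree (C * k)) f := by
  intro hf
  let F : List Bool → Fin c := fun l =>
    if h : l.length ≤ C * k then f ⟨l, h⟩ else f ⟨[], by simp⟩
  refine main_count F hk (Nat.mul_le_mul_right k hc) (lt_of_le_of_lt ?_ hbig) ?_
  · have : (C * k + 2) ^ c ≤ (C * k + 2) ^ C := Nat.pow_le_pow_right (by omega) hc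
    gcongr
  · intro L hL hch hnd han
    lift L to List (Vx (C * k)) using hL
    have hF : (L.map Subtype.val).map F = L.map f := by
      rw [List.map_map]
      apply List.map_congr_left
      intro x _
      simp [F, x.2]
    rw [hF] at han
    rw [List.isChain_map] at hch
    have hnd' := List.Nodup.of_map _ hnd
    cases L with
    | nil =>
      obtain ⟨w₁, w₂, h1, _, h3⟩ := han
      simp at h3
      exact h1 h3.1
    | cons x L =>
      obtain ⟨y, p, hp⟩ := exists_walk (tree (C * k)) x L hch
      refine hf p (SimpleGraph.Walk.IsPath.mk' (by rw [hp]; exact hnd')) ?_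
      rw [hp]
      exact han

end AnagramTree

/-- For every `d' ≥ 1` there is a tree with maximum degree at
most `d'` whose every anagram-free vertex colouring uses at least `d' - 1`
colours: `φ(T) ≥ d' - 1`. -/
theorem exists_tree_maxDegree_with_anagramFree_chromatic_ge (d' : ℕ) (hd : 1 ≤ d') :
    ∃ (V : Type) (G : SimpleGraph V), Finite V ∧ G.IsTree ∧
      (∀ v : V, (G.neighborSet v).ncard ≤ d') ∧
      ∀ c : ℕ, c < d' - 1 → ∀ f : V → Fin c, ¬ AnagramFreeVC G f := by
  by_cases h3 : 3 ≤ d'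
  · obtain ⟨k, hk, hbig⟩ := AnagramTree.exists_big d'
    exact ⟨AnagramTree.Vx (d' * k), AnagramTree.tree (d' * k), inferInstance,
      AnagramTree.tree_isTree _, fun v => (AnagramTree.tree_degree _ v).trans h3,
      fun c hc f => AnagramTree.tree_not_free d' c (by omega) k hk hbig f⟩
  · refine ⟨AnagramTree.Vx 0, AnagramTree.tree 0, inferInstance,
      AnagramTree.tree_isTree _, ?_, ?_⟩
    · intro v
      have : (AnagramTree.tree 0).neighborSet v = ∅ := by
        ext y
        simp only [SimpleGraph.mem_neighborSet, Set.mem_empty_iff_false, iff_false]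
        have hy := y.2
        have hv := v.2
        rintro (⟨a, h⟩ | ⟨a, h⟩) <;> simp [h] at hy hv
      simp [this]
    · intro c hc f
      have : c = 0 := by omega
      subst this
      exact (f ⟨[], by simp⟩).elim0
end

section
/- Let z ≥ 1 and k ≥ 2z be integers and y a positive integer such that every path P has a z-anagram-free vertex colouring using at most y colours (φ_z(P) ≤ y). Then every tree T has a k-anagram-free vertex colouring using at most y colours (φ_k(T) ≤ y). In particular, colouring each vertex of a rooted tree by the letter of a z-anagram-free word at position equal to its depth gives such a colouring. -/
theorem kaf_parent_unique {V : Type} {G : SimpleGraph V} (hG : G.IsTree) (r a b v : V)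
    (ha : G.Adj a v) (hb : G.Adj b v) (hda : G.dist r v = G.dist r a + 1)
    (hdb : G.dist r v = G.dist r b + 1) : a = b := by
  obtain ⟨p, hp⟩ := hG.connected.exists_walk_length_eq_dist r a
  obtain ⟨q, hq⟩ := hG.connected.exists_walk_length_eq_dist r b
  have h1 : (p.concat ha).IsPath :=
    SimpleGraph.Walk.isPath_of_length_eq_dist _ (by simp [hp, hda])
  have h2 : (q.concat hb).IsPath :=
    SimpleGraph.Walk.isPath_of_length_eq_dist _ (by simp [hq, hdb])
  have h3 := (hG.existsUnique_path r v).unique h1 h2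
  have h4 := congrArg SimpleGraph.Walk.penultimate h3
  simpa using h4

theorem kaf_interval_path (n M : ℕ) : ∀ c : ℕ, ∀ h : c + M < n,
    ∃ (v : Fin n) (p : (SimpleGraph.pathGraph n).Walk ⟨c, by omega⟩ v),
      p.support.map Fin.val = List.range' c (M + 1) := by
  induction M with
  | zero => exact fun c h => ⟨_, SimpleGraph.Walk.nil, by simp⟩
  | succ M ih =>
    intro c h
    obtain ⟨v, p, hp⟩ := ih (c + 1) (by omega)
    refine ⟨v, SimpleGraph.Walk.cons ?_ p, ?_⟩
    · simp [SimpleGraph.pathGraph_adj]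
    · rw [SimpleGraph.Walk.support_cons, List.map_cons, hp]
      simp [List.range'_succ]

theorem kaf_no_interval {z n y : ℕ} (f : Fin n → Fin y)
    (hf : KAnagramFreeVC z (SimpleGraph.pathGraph n) f) (w : ℕ → Fin y)
    (hw : ∀ i : Fin n, w i = f i) (c M : ℕ) (hM : 0 < M) (h : c + M ≤ n) :
    ¬ IsKAnagram z ((List.range' c M).map w) := by
  obtain ⟨M, rfl⟩ : ∃ M', M = M' + 1 := ⟨M - 1, by omega⟩
  obtain ⟨v, p, hp⟩ := kaf_interval_path n M c (by omega)
  have hpath : p.IsPath := by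
    rw [SimpleGraph.Walk.isPath_def]
    apply List.Nodup.of_map Fin.val
    rw [hp]
    exact List.nodup_range'
  have := hf p hpath
  rw [← hp, List.map_map]
  have e : w ∘ Fin.val = f := funext hw
  rwa [e]

theorem kaf_reverse {α : Type*} {z : ℕ} {l : List α} (h : IsKAnagram z l) :
    IsKAnagram z l.reverse := by
  obtain ⟨W, ws, hW, hl, hp, rfl⟩ := h
  refine ⟨W, (ws.map List.reverse).reverse, hW, by simpa using hl, ?_, ?_⟩
  · intro w hw
    simp only [List.mem_reverse, List.mem_map] at hw
    obtain ⟨a, ha, rfl⟩ := hw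
    exact (List.reverse_perm a).trans (hp a ha)
  · rw [List.reverse_flatten]

theorem kaf_length_flatten {α : Type*} (W : List α) (ws : List (List α))
    (h : ∀ w ∈ ws, List.Perm w W) : ws.flatten.length = ws.length * W.length := by
  induction ws with
  | nil => simp
  | cons a t ih =>
    rw [List.flatten_cons, List.length_append, ih (fun w hw => h w (by simp [hw])),
      (h a (by simp)).length_eq, List.length_cons]
    ring

theorem kaf_split {α : Type*} {z k : ℕ} (hz : 1 ≤ z) (hk : 2 * z ≤ k) {l : List α}
    (h : IsKAnagram k l) : ∃ M, 0 < M ∧ 2 * M ≤ l.length ∧ IsKAnagram z (l.take M) ∧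
      IsKAnagram z (l.drop (l.length - M)) := by
  obtain ⟨W, ws, hW, hl, hp, rfl⟩ := h
  have hWl : 0 < W.length := List.length_pos_iff.mpr hW
  have h1 : (ws.take z).flatten.length = z * W.length := by
    rw [kaf_length_flatten W _ (fun w hw => hp w (List.mem_of_mem_take hw)), List.length_take,
      hl, min_eq_left (by omega)]
  have h2 : (ws.take (k - z)).flatten.length = (k - z) * W.length := by
    rw [kaf_length_flatten W _ (fun w hw => hp w (List.mem_of_mem_take hw)), List.length_take,
      hl, min_eq_left (by omega)]
  have h3 := kaf_length_flatten W ws hp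
  rw [hl] at h3
  have h4 : k * W.length - z * W.length = (k - z) * W.length := by rw [Nat.sub_mul]
  refine ⟨z * W.length, by positivity, ?_, ⟨W, ws.take z, hW, by simp; omega,
    fun w hw => hp w (List.mem_of_mem_take hw), ?_⟩, ⟨W, ws.drop (k - z), hW, by simp; omega,
    fun w hw => hp w (List.mem_of_mem_drop hw), ?_⟩⟩
  · rw [h3]; nlinarith
  · conv_lhs => rw [← List.take_append_drop z ws, List.flatten_append]
    rw [← h1, List.take_left]
  · rw [h3, h4]
    conv_lhs => rw [← List.take_append_drop (k - z) ws, List.flatten_append]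
    rw [← h2, List.drop_left]

/-- A depth sequence without local maxima starts with a descent or ends with an ascent. -/
theorem kaf_depth (g : ℕ → ℕ) (L M : ℕ) (hL : 2 * M ≤ L)
    (h1 : ∀ i, i + 1 < L → g i = g (i + 1) + 1 ∨ g (i + 1) = g i + 1)
    (h2 : ∀ i, i + 2 < L → g (i + 1) = g i + 1 → g (i + 2) = g (i + 1) + 1) :
    (∀ i, i < M → g i + i = g 0) ∨ (∀ i, i < M → g (L - M + i) = g (L - M) + i) := by
  by_cases hA : ∀ i, i + 1 < M → g i = g (i + 1) + 1
  · left
    intro i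
    induction i with
    | zero => simp
    | succ i ih =>
      intro hi
      have := hA i hi
      have := ih (by omega)
      omega
  · right
    push Not at hA
    obtain ⟨j, hj, hne⟩ := hA
    have hj' : g (j + 1) = g j + 1 := (h1 j (by omega)).resolve_left hne
    have key : ∀ t, j + t + 1 < L → g (j + t + 1) = g (j + t) + 1 := by
      intro t
      induction t with
      | zero => exact fun _ => hj'
      | succ t ih => exact fun ht => h2 (j + t) (by omega) (ih (by omega))
    intro i
    induction i with
    | zero => simp
    | succ i ih =>
      intro hi
      have a := ih (by omega)
      have b := key (L - M + i - j) (by omega)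
      rw [show j + (L - M + i - j) = L - M + i by omega] at b
      rw [← add_assoc, b, a]
      ring

/-- Let `z ≥ 1`, `k ≥ 2z` and suppose every path has a
`z`-anagram-free vertex colouring with at most `y` colours.  Then every tree
has a `k`-anagram-free vertex colouring with at most `y` colours:
if `φ_z(P) ≤ y` for all paths `P` then `φ_k(T) ≤ y` for all trees `T`. -/
theorem kAnagramFree_tree_of_zAnagramFree_path (z k y : ℕ)
    (hz : 1 ≤ z) (hk : 2 * z ≤ k) (hy : 0 < y)
    (hpath : ∀ n : ℕ, ∃ f : Fin n → Fin y,
      KAnagramFreeVC z (SimpleGraph.pathGraph n) f) :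
    ∀ (V : Type) [Finite V] (G : SimpleGraph V), G.IsTree →
      ∃ f : V → Fin y, KAnagramFreeVC k G f := by
  intro V _ G hG
  obtain ⟨r⟩ := hG.connected.nonempty
  obtain ⟨n, hn⟩ : ∃ n, ∀ v, G.dist r v < n := by
    obtain ⟨B, hB⟩ := (Set.finite_range (fun v => G.dist r v)).bddAbove
    exact ⟨B + 1, fun v => Nat.lt_succ_of_le (hB ⟨v, rfl⟩)⟩
  obtain ⟨f, hf⟩ := hpath n
  let w : ℕ → Fin y := fun i => if h : i < n then f ⟨i, h⟩ else ⟨0, hy⟩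
  have hw : ∀ i : Fin n, w i = f i := fun i => by simp [w]
  refine ⟨fun v => w (G.dist r v), ?_⟩
  intro u v p hp hk'
  obtain ⟨M, hM, hML, hA, hB⟩ := kaf_split hz hk hk'
  have hlen : (p.support.map fun v => w (G.dist r v)).length = p.length + 1 := by simp
  rw [hlen] at hML hB
  let g : ℕ → ℕ := fun i => G.dist r (p.getVert i)
  have hgn : ∀ i, g i < n := fun i => hn _
  have hget : ∀ i (h : i < (p.support.map fun v => w (G.dist r v)).length),
      (p.support.map fun v => w (G.dist r v))[i] = w (g i) := by
    intro i h
    rw [hlen] at h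
    simp only [g, List.getElem_map]
    rw [SimpleGraph.Walk.getVert_eq_support_getElem p (by omega)]
  have h1 : ∀ i, i + 1 < p.length + 1 → g i = g (i + 1) + 1 ∨ g (i + 1) = g i + 1 :=
    fun i hi => hG.dist_eq_dist_add_one_of_adj r (p.adj_getVert_succ (by omega))
  have h2 : ∀ i, i + 2 < p.length + 1 → g (i + 1) = g i + 1 → g (i + 2) = g (i + 1) + 1 := by
    intro i hi hup
    rcases h1 (i + 1) (by omega) with h | h
    · have := kaf_parent_unique hG r (p.getVert i) (p.getVert (i + 2)) (p.getVert (i + 1))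
        (p.adj_getVert_succ (by omega)) (p.adj_getVert_succ (by omega)).symm hup h
      have := hp.getVert_injOn (by simp; omega) (by simp; omega) this
      omega
    · exact h
  rcases kaf_depth g (p.length + 1) M hML h1 h2 with h | h
  · have hl := h (M - 1) (by omega)
    refine kaf_no_interval f hf w hw (g (M - 1)) M hM ?_ ?_
    · have := hgn 0
      omega
    · have e : ((p.support.map fun v => w (G.dist r v)).take M).reverse
          = (List.range' (g (M - 1)) M).map w := by
        apply List.ext_getElem
        · rw [List.length_reverse, List.length_take, hlen]
          simp; omega
        · intro i hi hi'
          simp only [List.length_map, List.length_range'] at hi'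
          have hmin : min M (p.length + 1) = M := by omega
          rw [List.getElem_reverse, List.getElem_take, hget]
          simp only [List.getElem_map, List.getElem_range', List.length_take, hlen, hmin]
          have := h (M - 1 - i) (by omega)
          congr 1
          omega
      rw [← e]
      exact kaf_reverse hA
  · have hl := h (M - 1) (by omega)
    refine kaf_no_interval f hf w hw (g (p.length + 1 - M)) M hM ?_ ?_
    · have := hgn (p.length + 1 - M + (M - 1))
      omega
    · have e : ((p.support.map fun v => w (G.dist r v)).drop (p.length + 1 - M))
          = (List.range' (g (p.length + 1 - M)) M).map w := by
        apply List.ext_getElem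
        · rw [List.length_drop, hlen]
          simp; omega
        · intro i hi hi'
          simp only [List.length_map, List.length_range'] at hi'
          rw [List.getElem_drop, hget]
          simp only [List.getElem_map, List.getElem_range']
          rw [h i hi', one_mul]
      rw [← e]
      exact hB
end

section
/- Every tree T satisfies φ_6(T) ≤ 3 and φ_8(T) ≤ 2: every tree has a 6-anagram-free vertex colouring with 3 colours and an 8-anagram-free vertex colouring with 2 colours. -/
def HasPow {α : Type*} [DecidableEq α] (k : ℕ) (l : List α) : Prop :=
  ∃ (p : ℕ → ℕ) (D : α → ℕ), (∃ s, D s ≠ 0) ∧ (∀ j ≤ k, p j ≤ l.length) ∧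
    ∀ j ≤ k, ∀ s, (l.take (p j)).count s = (l.take (p 0)).count s + j * D s

theorem hasPow_of_sub {α : Type*} [DecidableEq α] {k : ℕ} {w W : List α} {ws : List (List α)}
    (hW : W ≠ []) (hk : ws.length = k) (hp : ∀ x ∈ ws, List.Perm x W)
    (h : ws.flatten <:+: w) : HasPow k w := by
  obtain ⟨x, y, rfl⟩ := h
  have hlen : ∀ us : List (List α), (∀ x ∈ us, List.Perm x W) →
      us.flatten.length = us.length * W.length := by
    intro us
    induction us with
    | nil => simp
    | cons a us ih =>
      intro h
      simp only [List.mem_cons, forall_eq_or_imp] at h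
      simp only [List.flatten_cons, List.length_append, List.length_cons, ih h.2, h.1.length_eq]
      ring
  have hcnt : ∀ s, ∀ us : List (List α), (∀ x ∈ us, List.Perm x W) →
      us.flatten.count s = us.length * W.count s := by
    intro s us
    induction us with
    | nil => simp
    | cons a us ih =>
      intro h
      simp only [List.mem_cons, forall_eq_or_imp] at h
      simp only [List.flatten_cons, List.count_append, List.length_cons, ih h.2, h.1.count_eq]
      ring
  have htake : ∀ j ≤ k, (x ++ ws.flatten ++ y).take (x.length + j * W.length)
      = x ++ (ws.take j).flatten := by
    intro j hj
    have h1 : (x ++ (ws.take j).flatten).length = x.length + j * W.length := by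
      rw [List.length_append, hlen _ (fun z hz => hp z (List.mem_of_mem_take hz)),
        List.length_take, hk, min_eq_left hj]
    have h2 : x ++ ws.flatten ++ y = (x ++ (ws.take j).flatten) ++ ((ws.drop j).flatten ++ y) := by
      have h3 : ws.flatten = (ws.take j).flatten ++ (ws.drop j).flatten := by
        rw [← List.flatten_append, List.take_append_drop]
      rw [h3]
      simp only [List.append_assoc]
    rw [h2, ← h1, List.take_left]
  refine ⟨fun j => x.length + j * W.length, fun s => W.count s, ?_, ?_, ?_⟩
  · obtain ⟨a, W', rfl⟩ := List.exists_cons_of_ne_nil hW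
    exact ⟨a, by simp⟩
  · intro j hj
    rw [List.length_append, List.length_append, hlen _ hp, hk]
    have := Nat.mul_le_mul_right W.length hj
    show x.length + j * W.length ≤ _
    omega
  · intro j hj s
    show List.count s (List.take (x.length + j * W.length) _) =
      List.count s (List.take (x.length + 0 * W.length) _) + _
    rw [htake j hj, htake 0 (Nat.zero_le _), List.count_append,
      hcnt s _ (fun z hz => hp z (List.mem_of_mem_take hz)), List.length_take, hk, min_eq_left hj]
    simp

def th3 : Fin 3 → List (Fin 3) := ![[0,0,1,2],[1,1,2],[0,2,2]]
def th2 : Fin 2 → List (Fin 2) := ![[0,1,1],[0,0,0,1]]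

theorem th3_0 : th3 0 = [0,0,1,2] := rfl
theorem th3_1 : th3 1 = [1,1,2] := rfl
theorem th3_2 : th3 2 = [0,2,2] := rfl
theorem th2_0 : th2 0 = [0,1,1] := rfl
theorem th2_1 : th2 1 = [0,0,0,1] := rfl

def E3 : Fin 4 → Fin 3 → ℤ := ![![0,0,0],![1,0,0],![0,-1,-1],![0,0,-1]]
def E2 : Fin 4 → Fin 2 → ℤ := ![![0,0],![1,0],![2,0],![0,-1]]

def At3 (l : List (Fin 3)) (p : ℕ) : Prop := ∃ q ≤ l.length, ∃ e : Fin 4,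
      (((l.flatMap th3).take p).count 0 : ℤ) = 2 * (l.take q).count 0 + (l.take q).count 2 + E3 e 0 ∧
      (((l.flatMap th3).take p).count 1 : ℤ) = (l.take q).count 0 + 2 * (l.take q).count 1 + E3 e 1 ∧
      (((l.flatMap th3).take p).count 2 : ℤ) =
        (l.take q).count 0 + (l.take q).count 1 + 2 * (l.take q).count 2 + E3 e 2

theorem cut3 (l : List (Fin 3)) : ∀ p, p ≤ (l.flatMap th3).length → At3 l p := by
  induction l with
  | nil => intro p hp; exact ⟨0, by simp, 0, by simp [E3]⟩
  | cons a l ih =>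
    intro p hp
    by_cases h : (th3 a).length ≤ p
    · obtain ⟨r, rfl⟩ := Nat.exists_eq_add_of_le h
      rw [List.flatMap_cons, List.length_append] at hp
      obtain ⟨q, hq, e, h0, h1, h2⟩ := ih r (by omega)
      refine ⟨q + 1, by simpa using hq, e, ?_⟩
      rw [List.flatMap_cons, List.take_length_add_append, List.take_succ_cons]
      simp only [List.count_append, List.count_cons]
      fin_cases a <;> simp [th3_0, th3_1, th3_2] <;> omega
    · push Not at h
      rw [At3, List.flatMap_cons, List.take_append_of_le_length h.le]
      fin_cases a <;> simp [th3] at h ⊢ <;> interval_cases p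
      · exact ⟨0, by simp, 0, by simp [E3]⟩
      · exact ⟨0, by simp, 1, by simp [E3]⟩
      · exact ⟨1, by simp, 2, by simp [E3]⟩
      · exact ⟨1, by simp, 3, by simp [E3]⟩
      · exact ⟨0, by simp, 0, by simp [E3]⟩
      · exact ⟨1, by simp, 2, by simp [E3]⟩
      · exact ⟨1, by simp, 3, by simp [E3]⟩
      · exact ⟨0, by simp, 0, by simp [E3]⟩
      · exact ⟨0, by simp, 1, by simp [E3]⟩
      · exact ⟨1, by simp, 3, by simp [E3]⟩

def At2 (l : List (Fin 2)) (p : ℕ) : Prop := ∃ q ≤ l.length, ∃ e : Fin 4,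
      (((l.flatMap th2).take p).count 0 : ℤ) = (l.take q).count 0 + 3 * (l.take q).count 1 + E2 e 0 ∧
      (((l.flatMap th2).take p).count 1 : ℤ) = 2 * (l.take q).count 0 + (l.take q).count 1 + E2 e 1

theorem cut2 (l : List (Fin 2)) : ∀ p, p ≤ (l.flatMap th2).length → At2 l p := by
  induction l with
  | nil => intro p hp; exact ⟨0, by simp, 0, by simp [E2]⟩
  | cons a l ih =>
    intro p hp
    by_cases h : (th2 a).length ≤ p
    · obtain ⟨r, rfl⟩ := Nat.exists_eq_add_of_le h
      rw [List.flatMap_cons, List.length_append] at hp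
      obtain ⟨q, hq, e, h0, h1⟩ := ih r (by omega)
      refine ⟨q + 1, by simpa using hq, e, ?_⟩
      rw [List.flatMap_cons, List.take_length_add_append, List.take_succ_cons]
      simp only [List.count_append, List.count_cons]
      fin_cases a <;> simp [th2_0, th2_1] <;> omega
    · push Not at h
      rw [At2, List.flatMap_cons, List.take_append_of_le_length h.le]
      fin_cases a <;> simp [th2] at h ⊢ <;> interval_cases p
      · exact ⟨0, by simp, 0, by simp [E2]⟩
      · exact ⟨0, by simp, 1, by simp [E2]⟩
      · exact ⟨1, by simp, 3, by simp [E2]⟩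
      · exact ⟨0, by simp, 0, by simp [E2]⟩
      · exact ⟨0, by simp, 1, by simp [E2]⟩
      · exact ⟨0, by simp, 2, by simp [E2]⟩
      · exact ⟨1, by simp, 3, by simp [E2]⟩

def F3 (e : Fin 4) : ℤ := 4 * E3 e 0 + E3 e 1 + 5 * E3 e 2
def F2 (e : Fin 4) : ℤ := E2 e 0 + 2 * E2 e 1

theorem ap3 : ∀ a b c d : Fin 4, (F3 a - 2 * F3 b + F3 c) % 7 = 0 → (F3 b - 2 * F3 c + F3 d) % 7 = 0 →
    b = a ∧ c = a ∧ d = a := by decide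
theorem ap2 : ∀ a b c : Fin 4, (F2 a - 2 * F2 b + F2 c) % 5 = 0 → ∀ d : Fin 4,
    (F2 b - 2 * F2 c + F2 d) % 5 = 0 → ∀ e : Fin 4, (F2 c - 2 * F2 d + F2 e) % 5 = 0 →
    b = a ∧ c = a ∧ d = a ∧ e = a := by decide

theorem pow3 (l : List (Fin 3)) (h : HasPow 3 (l.flatMap th3)) : HasPow 3 l := by
  obtain ⟨p, D, hD, hp, hc⟩ := h
  have H : ∀ j, j ≤ 3 → At3 l (p j) := fun j hj => cut3 l (p j) (hp j hj)
  unfold At3 at H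
  choose! q hq e h using H
  have hD' : D 0 ≠ 0 ∨ D 1 ≠ 0 ∨ D 2 ≠ 0 := by
    obtain ⟨s, hs⟩ := hD
    fin_cases s
    · exact Or.inl hs
    · exact Or.inr (Or.inl hs)
    · exact Or.inr (Or.inr (hs))
  have hm : ∀ i j, q i ≤ q j → ∀ s, (l.take (q i)).count s ≤ (l.take (q j)).count s :=
    fun i j hij s => (List.take_sublist_take_left hij).count_le s
  obtain ⟨X, hX⟩ : ∃ X : ℕ → Fin 3 → ℕ, ∀ j s, (l.take (q j)).count s = X j s :=
    ⟨_, fun _ _ => rfl⟩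
  obtain ⟨Y, hY⟩ : ∃ Y : ℕ → Fin 3 → ℕ, ∀ j s, ((l.flatMap th3).take (p j)).count s = Y j s :=
    ⟨_, fun _ _ => rfl⟩
  simp only [hX, hY] at h hm hc
  have key : ∀ j : ℕ, j ≤ 3 → (Y 0 0 + j * D 0 : ℤ) = 2 * (X j 0) + (X j 2) + E3 (e j) 0 ∧ (Y 0 1 + j * D 1 : ℤ) = (X j 0) + 2 * (X j 1) + E3 (e j) 1 ∧ (Y 0 2 + j * D 2 : ℤ) = (X j 0) + (X j 1) + 2 * (X j 2) + E3 (e j) 2 := by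
    intro j hj
    have := h j hj
    simp only [hc j hj] at this
    push_cast at this
    exact this
  clear h
  obtain ⟨k00, k01, k02⟩ := key 0 (by norm_num)
  obtain ⟨k10, k11, k12⟩ := key 1 (by norm_num)
  obtain ⟨k20, k21, k22⟩ := key 2 (by norm_num)
  obtain ⟨k30, k31, k32⟩ := key 3 (by norm_num)
  norm_num at k00 k01 k02 k10 k11 k12 k20 k21 k22 k30 k31 k32
  obtain ⟨e1, e2, e3⟩ := ap3 (e 0) (e 1) (e 2) (e 3) (by unfold F3; omega) (by unfold F3; omega)
  rw [e1] at k10 k11 k12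
  rw [e2] at k20 k21 k22
  rw [e3] at k30 k31 k32
  have d0 : (D 0 : ℤ) = 2 * ((X 1 0 : ℤ) - X 0 0) + ((X 1 2 : ℤ) - X 0 2) := by clear hD'; linarith
  have d1 : (D 1 : ℤ) = ((X 1 0 : ℤ) - X 0 0) + 2 * ((X 1 1 : ℤ) - X 0 1) := by clear hD'; linarith
  have d2 : (D 2 : ℤ) = ((X 1 0 : ℤ) - X 0 0) + ((X 1 1 : ℤ) - X 0 1) + 2 * ((X 1 2 : ℤ) - X 0 2) := by clear hD'; linarith
  have f20 : (2 * D 0 : ℤ) = 2 * ((X 2 0 : ℤ) - X 0 0) + ((X 2 2 : ℤ) - X 0 2) := by linarith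
  have f21 : (2 * D 1 : ℤ) = ((X 2 0 : ℤ) - X 0 0) + 2 * ((X 2 1 : ℤ) - X 0 1) := by linarith
  have f22 : (2 * D 2 : ℤ) = ((X 2 0 : ℤ) - X 0 0) + ((X 2 1 : ℤ) - X 0 1) + 2 * ((X 2 2 : ℤ) - X 0 2) := by linarith
  have g2 : (X 2 0 : ℤ) - X 0 0 = 2 * (X 1 0 - X 0 0) ∧ (X 2 1 : ℤ) - X 0 1 = 2 * (X 1 1 - X 0 1) ∧ (X 2 2 : ℤ) - X 0 2 = 2 * (X 1 2 - X 0 2) := by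
    refine ⟨?_, ?_, ?_⟩ <;> linarith
  have f30 : (3 * D 0 : ℤ) = 2 * ((X 3 0 : ℤ) - X 0 0) + ((X 3 2 : ℤ) - X 0 2) := by linarith
  have f31 : (3 * D 1 : ℤ) = ((X 3 0 : ℤ) - X 0 0) + 2 * ((X 3 1 : ℤ) - X 0 1) := by linarith
  have f32 : (3 * D 2 : ℤ) = ((X 3 0 : ℤ) - X 0 0) + ((X 3 1 : ℤ) - X 0 1) + 2 * ((X 3 2 : ℤ) - X 0 2) := by linarith
  have g3 : (X 3 0 : ℤ) - X 0 0 = 3 * (X 1 0 - X 0 0) ∧ (X 3 1 : ℤ) - X 0 1 = 3 * (X 1 1 - X 0 1) ∧ (X 3 2 : ℤ) - X 0 2 = 3 * (X 1 2 - X 0 2) := by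
    refine ⟨?_, ?_, ?_⟩ <;> linarith
  clear k00 k01 k02 k10 k11 k12 k20 k21 k22 k30 k31 k32 f20 f21 f22 f30 f31 f32 key
  have hle : q 0 ≤ q 1 := by
    by_contra hlt
    have hlt : q 1 ≤ q 0 := by omega
    have b0 := hm 1 0 hlt 0
    have b1 := hm 1 0 hlt 1
    have b2 := hm 1 0 hlt 2
    clear g2 g3
    omega
  have b0 := hm 0 1 hle 0
  have b1 := hm 0 1 hle 1
  have b2 := hm 0 1 hle 2
  have hb : ∀ s, X 0 s ≤ X 1 s := hm 0 1 hle
  have hg : ∀ j : ℕ, j ≤ 3 → ∀ s, (X j s : ℤ) - X 0 s = j * (X 1 s - X 0 s) := by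
    intro j hj s
    clear b0 b1 b2 hm hX hY hD'
    interval_cases j
    · simp
    · simp
    · obtain ⟨w0, w1, w2⟩ := g2
      fin_cases s
      · exact w0
      · exact w1
      · exact w2
    · obtain ⟨w0, w1, w2⟩ := g3
      fin_cases s
      · exact w0
      · exact w1
      · exact w2
  refine ⟨q, fun s => X 1 s - X 0 s, ?_, hq, ?_⟩
  · by_contra hcon
    push Not at hcon
    have u0 : X 1 0 - X 0 0 = 0 := hcon 0
    have u1 : X 1 1 - X 0 1 = 0 := hcon 1
    have u2 : X 1 2 - X 0 2 = 0 := hcon 2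
    clear g2 g3 hcon
    omega
  · intro j hj s
    rw [hX, hX]
    have v1 := hg j hj s
    have v2 := hb s
    zify [v2]
    linarith

theorem pow2 (l : List (Fin 2)) (h : HasPow 4 (l.flatMap th2)) : HasPow 4 l := by
  obtain ⟨p, D, hD, hp, hc⟩ := h
  have H : ∀ j, j ≤ 4 → At2 l (p j) := fun j hj => cut2 l (p j) (hp j hj)
  unfold At2 at H
  choose! q hq e h using H
  have hD' : D 0 ≠ 0 ∨ D 1 ≠ 0 := by
    obtain ⟨s, hs⟩ := hD
    fin_cases s
    · exact Or.inl hs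
    · exact Or.inr (hs)
  have hm : ∀ i j, q i ≤ q j → ∀ s, (l.take (q i)).count s ≤ (l.take (q j)).count s :=
    fun i j hij s => (List.take_sublist_take_left hij).count_le s
  obtain ⟨X, hX⟩ : ∃ X : ℕ → Fin 2 → ℕ, ∀ j s, (l.take (q j)).count s = X j s :=
    ⟨_, fun _ _ => rfl⟩
  obtain ⟨Y, hY⟩ : ∃ Y : ℕ → Fin 2 → ℕ, ∀ j s, ((l.flatMap th2).take (p j)).count s = Y j s :=
    ⟨_, fun _ _ => rfl⟩
  simp only [hX, hY] at h hm hc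
  have key : ∀ j : ℕ, j ≤ 4 → (Y 0 0 + j * D 0 : ℤ) = (X j 0) + 3 * (X j 1) + E2 (e j) 0 ∧ (Y 0 1 + j * D 1 : ℤ) = 2 * (X j 0) + (X j 1) + E2 (e j) 1 := by
    intro j hj
    have := h j hj
    simp only [hc j hj] at this
    push_cast at this
    exact this
  clear h
  obtain ⟨k00, k01⟩ := key 0 (by norm_num)
  obtain ⟨k10, k11⟩ := key 1 (by norm_num)
  obtain ⟨k20, k21⟩ := key 2 (by norm_num)
  obtain ⟨k30, k31⟩ := key 3 (by norm_num)
  obtain ⟨k40, k41⟩ := key 4 (by norm_num)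
  norm_num at k00 k01 k10 k11 k20 k21 k30 k31 k40 k41
  obtain ⟨e1, e2, e3, e4⟩ := ap2 (e 0) (e 1) (e 2) (by unfold F2; omega) (e 3)
    (by unfold F2; omega) (e 4) (by unfold F2; omega)
  rw [e1] at k10 k11
  rw [e2] at k20 k21
  rw [e3] at k30 k31
  rw [e4] at k40 k41
  have d0 : (D 0 : ℤ) = ((X 1 0 : ℤ) - X 0 0) + 3 * ((X 1 1 : ℤ) - X 0 1) := by clear hD'; linarith
  have d1 : (D 1 : ℤ) = 2 * ((X 1 0 : ℤ) - X 0 0) + ((X 1 1 : ℤ) - X 0 1) := by clear hD'; linarith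
  have f20 : (2 * D 0 : ℤ) = ((X 2 0 : ℤ) - X 0 0) + 3 * ((X 2 1 : ℤ) - X 0 1) := by linarith
  have f21 : (2 * D 1 : ℤ) = 2 * ((X 2 0 : ℤ) - X 0 0) + ((X 2 1 : ℤ) - X 0 1) := by linarith
  have g2 : (X 2 0 : ℤ) - X 0 0 = 2 * (X 1 0 - X 0 0) ∧ (X 2 1 : ℤ) - X 0 1 = 2 * (X 1 1 - X 0 1) := by
    refine ⟨?_, ?_⟩ <;> linarith
  have f30 : (3 * D 0 : ℤ) = ((X 3 0 : ℤ) - X 0 0) + 3 * ((X 3 1 : ℤ) - X 0 1) := by linarith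
  have f31 : (3 * D 1 : ℤ) = 2 * ((X 3 0 : ℤ) - X 0 0) + ((X 3 1 : ℤ) - X 0 1) := by linarith
  have g3 : (X 3 0 : ℤ) - X 0 0 = 3 * (X 1 0 - X 0 0) ∧ (X 3 1 : ℤ) - X 0 1 = 3 * (X 1 1 - X 0 1) := by
    refine ⟨?_, ?_⟩ <;> linarith
  have f40 : (4 * D 0 : ℤ) = ((X 4 0 : ℤ) - X 0 0) + 3 * ((X 4 1 : ℤ) - X 0 1) := by linarith
  have f41 : (4 * D 1 : ℤ) = 2 * ((X 4 0 : ℤ) - X 0 0) + ((X 4 1 : ℤ) - X 0 1) := by linarith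
  have g4 : (X 4 0 : ℤ) - X 0 0 = 4 * (X 1 0 - X 0 0) ∧ (X 4 1 : ℤ) - X 0 1 = 4 * (X 1 1 - X 0 1) := by
    refine ⟨?_, ?_⟩ <;> linarith
  clear k00 k01 k10 k11 k20 k21 k30 k31 k40 k41 f20 f21 f30 f31 f40 f41 key
  have hle : q 0 ≤ q 1 := by
    by_contra hlt
    have hlt : q 1 ≤ q 0 := by omega
    have b0 := hm 1 0 hlt 0
    have b1 := hm 1 0 hlt 1
    clear g2 g3 g4
    omega
  have b0 := hm 0 1 hle 0
  have b1 := hm 0 1 hle 1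
  have hb : ∀ s, X 0 s ≤ X 1 s := hm 0 1 hle
  have hg : ∀ j : ℕ, j ≤ 4 → ∀ s, (X j s : ℤ) - X 0 s = j * (X 1 s - X 0 s) := by
    intro j hj s
    clear b0 b1 hm hX hY hD'
    interval_cases j
    · simp
    · simp
    · obtain ⟨w0, w1⟩ := g2
      fin_cases s
      · exact w0
      · exact w1
    · obtain ⟨w0, w1⟩ := g3
      fin_cases s
      · exact w0
      · exact w1
    · obtain ⟨w0, w1⟩ := g4
      fin_cases s
      · exact w0
      · exact w1
  refine ⟨q, fun s => X 1 s - X 0 s, ?_, hq, ?_⟩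
  · by_contra hcon
    push Not at hcon
    have u0 : X 1 0 - X 0 0 = 0 := hcon 0
    have u1 : X 1 1 - X 0 1 = 0 := hcon 1
    clear g2 g3 g4 hcon
    omega
  · intro j hj s
    rw [hX, hX]
    have v1 := hg j hj s
    have v2 := hb s
    zify [v2]
    linarith

theorem hasPow_length {α : Type*} [DecidableEq α] {k : ℕ} {l : List α} (h : HasPow k l) :
    k ≤ l.length := by
  obtain ⟨p, D, ⟨s, hs⟩, hp, hc⟩ := h
  have h1 := hc k le_rfl s
  have h2 : ((l.take (p k)).count s) ≤ l.length :=
    List.count_le_length.trans (by simp)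
  have h3 : k ≤ k * D s := Nat.le_mul_of_pos_right k (Nat.pos_of_ne_zero hs)
  omega

theorem words {α : Type*} [DecidableEq α] (a : α) (k : ℕ) (hk : 2 ≤ k) (th : α → List α)
    (h3 : ∀ s, 3 ≤ (th s).length) (hpow : ∀ l, HasPow k (l.flatMap th) → HasPow k l) (n : ℕ) :
    ∃ l : List α, n < l.length ∧ ¬ HasPow k l := by
  have hlen : ∀ l : List α, 3 * l.length ≤ (l.flatMap th).length := by
    intro l
    induction l with
    | nil => simp
    | cons b l ih =>
      have := h3 b
      simp only [List.flatMap_cons, List.length_append, List.length_cons]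
      omega
  induction n with
  | zero => exact ⟨[a], by simp, fun h => by have := hasPow_length h; simp at this; omega⟩
  | succ n ih =>
    obtain ⟨l, h, h'⟩ := ih
    exact ⟨l.flatMap th, by have := hlen l; omega, fun h => h' (hpow l h)⟩

theorem parent_unique {V : Type} {G : SimpleGraph V} (hG : G.IsTree) (r : V) {x y u : V}
    (hx : G.Adj x u) (hy : G.Adj y u) (dx : G.dist r u = G.dist r x + 1)
    (dy : G.dist r u = G.dist r y + 1) : x = y := by
  obtain ⟨p, hp⟩ := hG.connected.exists_walk_length_eq_dist r x
  obtain ⟨q, hq⟩ := hG.connected.exists_walk_length_eq_dist r y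
  have h1 : (p.concat hx).IsPath :=
    SimpleGraph.Walk.isPath_of_length_eq_dist _ (by rw [SimpleGraph.Walk.length_concat]; omega)
  have h2 : (q.concat hy).IsPath :=
    SimpleGraph.Walk.isPath_of_length_eq_dist _ (by rw [SimpleGraph.Walk.length_concat]; omega)
  have h3 : p.concat hx = q.concat hy := (hG.existsUnique_path r u).unique h1 h2
  have h4 := congrArg SimpleGraph.Walk.penultimate h3
  simpa using h4

theorem turning {V : Type} {G : SimpleGraph V} (hG : G.IsTree) (r : V) {u v : V}
    (p : G.Walk u v) (hp : p.IsPath) : ∃ t ≤ p.length,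
      (∀ i ≤ t, G.dist r (p.getVert i) + i = G.dist r u) ∧
      (∀ i, t ≤ i → i ≤ p.length → G.dist r (p.getVert i) + t = G.dist r (p.getVert t) + i) := by
  induction p with
  | nil => exact ⟨0, by simp, by simp, by simp⟩
  | @cons u u' v h p ih =>
    obtain ⟨t, ht, h1, h2⟩ := ih hp.of_cons
    have hnot : u ∉ p.support := ((SimpleGraph.Walk.cons_isPath_iff h p).1 hp).2
    rcases hG.dist_eq_dist_add_one_of_adj r h with hd | hd
    · refine ⟨t + 1, by simpa using ht, ?_, ?_⟩
      · intro i hi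
        cases i with
        | zero => simp
        | succ i =>
          have := h1 i (by omega)
          rw [SimpleGraph.Walk.getVert_cons_succ]
          omega
      · intro i hi hi'
        cases i with
        | zero => omega
        | succ i =>
          rw [SimpleGraph.Walk.length_cons] at hi'
          have := h2 i (by omega) (by omega)
          rw [SimpleGraph.Walk.getVert_cons_succ, SimpleGraph.Walk.getVert_cons_succ]
          omega
    · have ht0 : t = 0 := by
        by_contra hne
        have a1 := h1 1 (by omega)
        have hadj : G.Adj (p.getVert 0) (p.getVert 1) :=
          p.adj_getVert_succ (by omega)
        rw [SimpleGraph.Walk.getVert_zero] at hadj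
        have : u = p.getVert 1 := parent_unique hG r h hadj.symm hd (by omega)
        exact hnot (this ▸ p.getVert_mem_support 1)
      subst ht0
      refine ⟨0, by simp, by simp, ?_⟩
      intro i hi hi'
      cases i with
      | zero => simp
      | succ i =>
        rw [SimpleGraph.Walk.length_cons] at hi'
        have := h2 i (by omega) (by omega)
        rw [SimpleGraph.Walk.getVert_zero] at this
        rw [SimpleGraph.Walk.getVert_cons_succ, SimpleGraph.Walk.getVert_zero]
        omega

theorem sub_of_getElem {α : Type*} (X w : List α) (a : ℕ)
    (h : ∀ i < X.length, X[i]? = w[a + i]?) : X <:+: w := by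
  have : X = (w.drop a).take X.length := by
    apply List.ext_getElem?
    intro i
    rw [List.getElem?_take]
    split_ifs with hi
    · rw [h i hi, List.getElem?_drop]
    · exact List.getElem?_eq_none (by omega)
  rw [this]
  exact (List.take_prefix _ _).isInfix.trans (List.drop_suffix _ _).isInfix

theorem tree_colour {V : Type} {α : Type} [DecidableEq α] [Inhabited α] {G : SimpleGraph V}
    (hG : G.IsTree) (r : V) (k : ℕ) (w : List α) (hlen : ∀ v, G.dist r v < w.length)
    (hw : ¬ HasPow k w) : KAnagramFreeVC (k + k) G (fun v => w.getD (G.dist r v) default) := by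
  intro u v p hp ⟨W, ws, hW, hk, hperm, heq⟩
  apply hw
  obtain ⟨t, ht, h1, h2⟩ := turning hG r p hp
  have hsplit : ws.flatten = (ws.take k).flatten ++ (ws.drop k).flatten := by
    rw [← List.flatten_append, List.take_append_drop]
  set A := (ws.take k).flatten with hA
  set B := (ws.drop k).flatten with hB
  have hpA : ∀ x ∈ ws.take k, List.Perm x W := fun x hx => hperm x (List.mem_of_mem_take hx)
  have hpB : ∀ x ∈ ws.drop k, List.Perm x W := fun x hx => hperm x (List.mem_of_mem_drop hx)
  have hlA : (ws.take k).length = k := by rw [List.length_take]; omega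
  have hlB : (ws.drop k).length = k := by rw [List.length_drop]; omega
  rw [hsplit] at heq
  have hL : A.length + B.length = p.length + 1 := by
    rw [← List.length_append, ← heq, List.length_map, SimpleGraph.Walk.length_support]
  have hget : ∀ i ≤ p.length, (A ++ B)[i]? = w[G.dist r (p.getVert i)]? := by
    intro i hi
    rw [← heq, List.getElem?_map, ← SimpleGraph.Walk.getVert_eq_support_getElem? p hi,
      List.getElem?_eq_getElem (hlen _)]
    simp [List.getD_eq_getElem?_getD, List.getElem?_eq_getElem (hlen _)]
  by_cases hc : A.length ≤ t + 1
  · -- the first half is going up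
    refine hasPow_of_sub (k := k) (W := W) (ws := ((ws.take k).map List.reverse).reverse) hW
      (by simpa using hlA) ?_ ?_
    · intro x hx
      rw [List.mem_reverse, List.mem_map] at hx
      obtain ⟨y, hy, rfl⟩ := hx
      exact (List.reverse_perm y).trans (hpA y hy)
    · rw [← List.reverse_flatten, ← hA]
      apply sub_of_getElem _ _ (G.dist r u + 1 - A.length)
      intro i hi
      rw [List.length_reverse] at hi
      rw [List.getElem?_reverse hi]
      have a1 := hget (A.length - 1 - i) (by omega)
      rw [List.getElem?_append_left (by omega)] at a1
      have a2 := h1 (A.length - 1 - i) (by omega)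
      have a3 := h1 (A.length - 1) (by omega)
      rw [a1]
      congr 1
      omega
  · refine hasPow_of_sub hW hlB hpB ?_
    rw [← hB]
    apply sub_of_getElem _ _ (G.dist r (p.getVert t) + A.length - t)
    intro i hi
    have a1 := hget (A.length + i) (by omega)
    rw [List.getElem?_append_right (by omega), Nat.add_sub_cancel_left] at a1
    have a2 := h2 (A.length + i) (by omega) (by omega)
    rw [a1]
    congr 1
    omega

theorem sixAnagram_three_and_eightAnagram_two_of_tree {V : Type} [Finite V]
    (G : SimpleGraph V) (hG : G.IsTree) :
    (∃ f : V → Fin 3, KAnagramFreeVC 6 G f) ∧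
    (∃ f : V → Fin 2, KAnagramFreeVC 8 G f) := by
  obtain ⟨r⟩ := hG.connected.nonempty
  obtain ⟨N, hN⟩ := (Set.finite_range (fun v => G.dist r v)).bddAbove
  have hN' : ∀ v, G.dist r v ≤ N := fun v => hN ⟨v, rfl⟩
  obtain ⟨w3, l3, n3⟩ := words (0 : Fin 3) 3 (by norm_num) th3 (by decide) pow3 N
  obtain ⟨w2, l2, n2⟩ := words (0 : Fin 2) 4 (by norm_num) th2 (by decide) pow2 N
  exact ⟨⟨_, tree_colour hG r 3 w3 (fun v => (hN' v).trans_lt l3) n3⟩,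
    ⟨_, tree_colour hG r 4 w2 (fun v => (hN' v).trans_lt l2) n2⟩⟩
end

section
/- Every cycle C satisfies φ(C) ≤ 5: every cycle graph has an anagram-free vertex colouring using at most 5 colours (obtained by giving one vertex a unique colour and anagram-free 4-colouring the remaining path using Keränen's arbitrarily long anagram-free words on 4 symbols). -/
/-- The image of the first letter under the morphism. -/
def kerC : List ℕ := [0, 1, 2, 0, 2, 3, 2, 1, 2, 3, 2, 0, 3, 2, 3, 1, 3, 0, 1, 0, 2, 0, 1, 0, 3, 1, 0, 1, 2, 1, 3, 1, 2, 1, 0, 2, 1, 2, 3, 2, 0, 2, 1, 0, 1, 3, 0, 1, 0, 2, 0, 3, 2, 1, 2, 3, 2, 0, 2, 3, 1, 2, 1, 0, 2, 1, 2, 3, 2, 0, 2, 3, 2, 1, 3, 2, 3, 0, 3, 1, 3, 2, 1, 2, 0]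

/-- Table entry: residue of the functional, letter, offset, prefix Parikh vector. -/
structure KerE where
  g : ℕ
  a : ℕ
  r : ℕ
  x : ℕ
  y : ℕ
  z : ℕ
  w : ℕ

/-- Table row: offset, bit mask of the residues, bit mask of the doubled residues, entries. -/
structure KerR where
  r : ℕ
  A : ℕ
  D : ℕ
  l : List KerE

/-- Number of letters `b` in the length `r` prefix of the image of the letter `a`. -/
def kerV (a r b : ℕ) : ℕ := (kerC.take r).countP (fun t => Nat.beq (Nat.mod (Nat.add a t) 4) b)

def kerMk (a r : ℕ) : KerE :=
  ⟨(321 * kerV a r 0 + 491 * kerV a r 1 + 482 * kerV a r 2 + 239 * kerV a r 3) % 511,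
    a, r, kerV a r 0, kerV a r 1, kerV a r 2, kerV a r 3⟩

/-- Incidence matrix of the morphism. -/
def kerM (a b : ℕ) : ℕ :=
  match (b + 4 - a) % 4 with
  | 0 => 19
  | 1 => 21
  | 2 => 27
  | _ => 18

def kerAll {α : Type} (l : List α) (p : α → Bool) : Bool :=
  List.rec true (fun x _ ih => Bool.rec false ih (p x)) l

theorem kerAll_mem {α : Type} {l : List α} {p : α → Bool} (h : kerAll l p = true) :
    ∀ x ∈ l, p x = true := by
  induction l with
  | nil => simp
  | cons y t ih =>
    have h' : (Bool.rec false (kerAll t p) (p y) : Bool) = true := h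
    intro x hx
    cases hy : p y with
    | false => rw [hy] at h'; simp at h'
    | true =>
      rw [hy] at h'
      rcases List.mem_cons.1 hx with rfl | hx
      · exact hy
      · exact ih h' x hx

/-- The vector identity for a choice of boundary shifts. -/
def kerEq (d₀ d₁ d₂ : ℕ) (e₀ e₁ e₂ : KerE) : Prop :=
  (e₀.x + e₂.x + 2 * d₁ * kerM e₁.a 0 = 2 * e₁.x + d₀ * kerM e₀.a 0 + d₂ * kerM e₂.a 0) ∧
  (e₀.y + e₂.y + 2 * d₁ * kerM e₁.a 1 = 2 * e₁.y + d₀ * kerM e₀.a 1 + d₂ * kerM e₂.a 1) ∧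
  (e₀.z + e₂.z + 2 * d₁ * kerM e₁.a 2 = 2 * e₁.z + d₀ * kerM e₀.a 2 + d₂ * kerM e₂.a 2) ∧
  (e₀.w + e₂.w + 2 * d₁ * kerM e₁.a 3 = 2 * e₁.w + d₀ * kerM e₀.a 3 + d₂ * kerM e₂.a 3)

instance (d₀ d₁ d₂ : ℕ) (e₀ e₁ e₂ : KerE) : Decidable (kerEq d₀ d₁ d₂ e₀ e₁ e₂) := by
  unfold kerEq; infer_instance

/-- Not a square inside one block. -/
def kerDegA (e₀ e₁ e₂ : KerE) : Prop :=
  e₀.a = e₁.a → e₁.a = e₂.a → e₀.r < e₁.r →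
    ¬ (e₀.x + e₂.x = 2 * e₁.x ∧ e₀.y + e₂.y = 2 * e₁.y ∧
      e₀.z + e₂.z = 2 * e₁.z ∧ e₀.w + e₂.w = 2 * e₁.w)

/-- Not a square in two blocks with centre in the first block. -/
def kerDegB (e₀ e₁ e₂ : KerE) : Prop :=
  e₀.a = e₁.a → e₁.a ≠ e₂.a → e₀.r < e₁.r →
    ¬ (e₀.x + e₂.x + kerM e₀.a 0 = 2 * e₁.x ∧ e₀.y + e₂.y + kerM e₀.a 1 = 2 * e₁.y ∧
      e₀.z + e₂.z + kerM e₀.a 2 = 2 * e₁.z ∧ e₀.w + e₂.w + kerM e₀.a 3 = 2 * e₁.w)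

/-- Not a square in two blocks with centre in the second block. -/
def kerDegC (e₀ e₁ e₂ : KerE) : Prop :=
  e₀.a ≠ e₁.a → e₁.a = e₂.a → e₁.r < e₂.r →
    ¬ (e₀.x + e₂.x = 2 * e₁.x + kerM e₀.a 0 ∧ e₀.y + e₂.y = 2 * e₁.y + kerM e₀.a 1 ∧
      e₀.z + e₂.z = 2 * e₁.z + kerM e₀.a 2 ∧ e₀.w + e₂.w = 2 * e₁.w + kerM e₀.a 3)

/-- Some boundary shift works. -/
def kerShift (e₀ e₁ e₂ : KerE) : Prop :=
  kerEq 0 0 0 e₀ e₁ e₂ ∨ kerEq 1 1 1 e₀ e₁ e₂ ∨ kerEq 0 0 1 e₀ e₁ e₂ ∨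
    kerEq 0 1 1 e₀ e₁ e₂ ∨ kerEq 1 1 0 e₀ e₁ e₂ ∨ kerEq 1 0 0 e₀ e₁ e₂

instance (e₀ e₁ e₂ : KerE) : Decidable (kerDegA e₀ e₁ e₂) := by
  unfold kerDegA; infer_instance

instance (e₀ e₁ e₂ : KerE) : Decidable (kerDegB e₀ e₁ e₂) := by
  unfold kerDegB; infer_instance

instance (e₀ e₁ e₂ : KerE) : Decidable (kerDegC e₀ e₁ e₂) := by
  unfold kerDegC; infer_instance

instance (e₀ e₁ e₂ : KerE) : Decidable (kerShift e₀ e₁ e₂) := by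
  unfold kerShift; infer_instance

def kerGood (e₀ e₁ e₂ : KerE) : Prop :=
  kerShift e₀ e₁ e₂ ∧ kerDegA e₀ e₁ e₂ ∧ kerDegB e₀ e₁ e₂ ∧ kerDegC e₀ e₁ e₂

instance (e₀ e₁ e₂ : KerE) : Decidable (kerGood e₀ e₁ e₂) := by
  unfold kerGood; infer_instance

def kerTst (e₀ e₁ e₂ : KerE) : Bool :=
  Bool.rec true (decide (kerGood e₀ e₁ e₂))
    (Nat.beq (Nat.mod (Nat.add e₀.g e₂.g) 511) (Nat.mod (Nat.add e₁.g e₁.g) 511))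

/-- Prefix Parikh vectors of the four blocks. -/
def kerT : List KerR := [
  ⟨0, 1,
    6703903964971298549787012499102923063739682910296196688861780721860882015036773488400937149083451713845015929093243025426876941405973284973216824503042049,
    [⟨0, 0, 0, 0, 0, 0, 0⟩, ⟨0, 1, 0, 0, 0, 0, 0⟩, ⟨0, 2, 0, 0, 0, 0, 0⟩, ⟨0, 3, 0, 0, 0, 0, 0⟩]⟩,
  ⟨1, 6405828025248416058795037515535577259396123388748525073537061922971427598102454815123486521060121886875876216002255776569348616854060410473327624192,
    5272850586490991147211189483680402750467933807989273709566530040626222156773632596941413787644145165534137994533958185518368918992066321972729110416601453593230926845228130202214603560610156396393589145653305036571208825163417914303996131002298146845881938093379984764113603998895156670735809773568,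
    [⟨321, 0, 1, 1, 0, 0, 0⟩, ⟨491, 1, 1, 0, 1, 0, 0⟩, ⟨482, 2, 1, 0, 0, 1, 0⟩, ⟨239, 3, 1, 0, 0, 0, 1⟩]⟩,
  ⟨2, 11908525658859223294760121268437066290850060053505093171604604395548130987828375836655738317723789099831362785400756557728191729308891348992,
    18293874854434396276564604021199910379117256738096416971034485802817949750298706454022094017982882659689847096300909752221931073974795100200978327881342464499213790159921413031764519347802732505146196724692162707197896094993332175109258135664482568339505994253350579961050106429440,
    [⟨301, 0, 2, 1, 1, 0, 0⟩, ⟨462, 1, 2, 0, 1, 1, 0⟩, ⟨210, 2, 2, 0, 0, 1, 1⟩, ⟨49, 3, 2, 1, 0, 0, 1⟩]⟩,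
  ⟨3, 7588550360256754183279149642804804575742092673994775806806496251131455980629393408,
    16509204097989538948510618278641143953713978938628797566498772157083559454897651858575539246489289053984764958626007344758315588412022165748109840176206317603214164510691670641129895054718280042574437497605981543124622034072869033319023175578938414004832769599562842112,
    [⟨272, 0, 3, 1, 1, 1, 0⟩, ⟨190, 1, 3, 0, 1, 1, 1⟩, ⟨20, 2, 3, 1, 0, 1, 1⟩, ⟨29, 3, 3, 1, 1, 0, 1⟩]⟩,
  ⟨4, 13093562431584567480052758787310396608866568184172259157933165472384535659903095735580216824250371225685794980130942062741192605338982759211684738367488,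
    171441377149802771351748007849600289689824769887900410848609462599198483571008293321535259797610344530535212389368724599599619506458057988848057992481723180094166280471797457799937531187232214491728811844430070543936190960245538114260758939194866224145284412021360036024389485165644412910998619825373184,
    [⟨82, 0, 4, 2, 1, 1, 0⟩, ⟨170, 1, 4, 0, 2, 1, 1⟩, ⟨502, 2, 4, 1, 0, 2, 1⟩, ⟨268, 3, 4, 1, 1, 0, 2⟩]⟩,
  ⟨5, 1322111937580497197903830616073885779015875420938370304957605669884851721173268553673035888037586273952292191393304077664256,
    1371531017198422170813984062796802317518598158983083017529748477089542201958742625459120758288065413928966362763267014705250916867023295817406673007322486237415531557177900359114580395702391365677989657026020732603672886054795473632305786361805292184376936313942516459914147047035449172569455410313953280,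
    [⟨53, 0, 5, 2, 1, 2, 0⟩, ⟨409, 1, 5, 0, 2, 1, 2⟩, ⟨312, 2, 5, 2, 0, 2, 1⟩, ⟨248, 3, 5, 1, 2, 0, 2⟩]⟩,
  ⟨6, 7957171782556586274486958468682481899100881756979032842505974791053756345090568496349184,
    4758454107128905800953799994079681792420032645310062268978469949811010102913293995344538606387700321887355916191934096538569433505232343645960338508521288882219179402360618008472317279371338833313655394390787360039193318265195685396211663625091978277062352975687927071734736742948798464,
    [⟨292, 0, 6, 2, 1, 2, 1⟩, ⟨219, 1, 6, 1, 2, 1, 2⟩, ⟨292, 2, 6, 2, 1, 2, 1⟩, ⟨219, 3, 6, 1, 2, 1, 2⟩]⟩,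
  ⟨7, 744282853678701455922507579277316643178128753343813693728260785348397007501134494041122877478236880673304199768917278789106942331525791744,
    558284755079174691057269409826657421237709251040540068696120954920833348594168101569817456885943823890613929957995377619067297546155276875994382166421967510728179957942759201060884079727152607139612786198545715823642113613719656347426023945797979833691717310942139789263011840,
    [⟨263, 0, 7, 2, 1, 3, 1⟩, ⟨458, 1, 7, 1, 2, 1, 3⟩, ⟨102, 2, 7, 3, 1, 2, 1⟩, ⟨199, 3, 7, 1, 3, 1, 2⟩]⟩,
  ⟨8, 1386334847060407429789207096551031336073826958802792848736263123068828723008778261325908753106273402584022447907429622068042269184,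
    1339385758982834151185531311325002263201757936556225183307946858079308864275926648926953922192545278027777828855243202450045307259946352180714945977844438841064518517670339681443789649535149928176702694077441013204951650589497104264230172584156526126433509847677701697030417210152766288683183712239616,
    [⟨243, 0, 8, 2, 2, 3, 1⟩, ⟨429, 1, 8, 1, 2, 2, 3⟩, ⟨341, 2, 8, 3, 1, 2, 2⟩, ⟨9, 3, 8, 2, 3, 1, 2⟩]⟩,
  ⟨9, 3273390607896141870013189696827599152216642046043064789483291368096133796404674554883296420398821296447746705834532763401834557495763964698871862394880,
    10715086071862673214131178329593090176857993423773775548643753251208904371533659912998562594421019391364232517887312007144150999573041968033592055811475362530753418703573955538496259393551847996799746855625387829640733831768676200678275959419136739473347267577236712890983997864664012988735178716217344,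
    [⟨214, 0, 9, 2, 2, 4, 1⟩, ⟨157, 1, 9, 1, 2, 2, 4⟩, ⟨151, 2, 9, 4, 1, 2, 2⟩, ⟨500, 3, 9, 2, 4, 1, 2⟩]⟩,
  ⟨10, 786534325975173157631736987116093206794209865730158851487988959850797612662780979385607545061532498386565089958534211942430066617287387520172032,
    609119301135212428072256233725865281739707214617734530640062987814353536645864028458315870679964499461350622749967865949206563062470159538665828990050745928414256635215795491342550927283534168858931078220921121270228039969131696460087415385426106801445818557762018663319310135661636354048,
    [⟨453, 0, 10, 2, 2, 4, 2⟩, ⟨478, 1, 10, 2, 2, 2, 4⟩, ⟨131, 2, 10, 4, 2, 2, 2⟩, ⟨471, 3, 10, 2, 4, 2, 2⟩]⟩,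
  ⟨11, 17444129426417529343821503570224830451723075522689962749502898767374086361927852129124060954764611242745315832883546933278859990373761024,
    70906660738104212546852043043441903061601256100011685505019020526154538509589989386578280680648509860319413744125590056209619649598810479933253424309876376492325693848709232013113612073111054952998169941428603140731480440869574875972704057225672563518707602544374620597981806592,
    [⟨424, 0, 11, 2, 2, 5, 2⟩, ⟨206, 1, 11, 2, 2, 2, 5⟩, ⟨452, 2, 11, 5, 2, 2, 2⟩, ⟨451, 3, 11, 2, 5, 2, 2⟩]⟩,
  ⟨12, 21661481985318866090456360813617841433097164651373566993546978708938891321227151589298739513611778140969492725265288882651398144,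
    5109351192408882717840314145438799743741899223392865373780161969721688305387212516760335302153313201779909983478110886319713125491651993292060257831349679292955184830303632993023735472041115503716190974851954356493684335953278628833903695805975282608633096826679003301332645017355449954295873536,
    [⟨234, 0, 12, 3, 2, 5, 2⟩, ⟨186, 1, 12, 2, 3, 2, 5⟩, ⟨423, 2, 12, 5, 2, 3, 2⟩, ⟨179, 3, 12, 2, 5, 2, 3⟩]⟩,
  ⟨13, 418993997835094819911031970501622077840513988925890463396807406327386927333214193522690635999757948726473162749818566857351920240181474295691409623089152,
    175555970201398037864784766801381809867499789349094586467636581794108556242184069909658980651324238714772755267808404872971079818770552192962288206346887678780567202892267291840698901215329259477850147848834209439891191431457906497798792825961410224820679021394291861672159778427805934232796196876928942080,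
    [⟨473, 0, 13, 3, 2, 5, 3⟩, ⟨507, 1, 13, 3, 3, 2, 5⟩, ⟨403, 2, 13, 5, 3, 3, 2⟩, ⟨150, 3, 13, 2, 5, 3, 3⟩]⟩,
  ⟨14, 45427420268475430659332737993000283397102585042957378767593137504003939445448339077013324807581248055428252993495507129214740253900800,
    20437404769636692603321004851578688415106072885235515056848773171112579200237553789280558559896887115817861397088944726474816047683325543664117950720932329162530101988741729049651725173728615303253867433415132957794843985078905183711604426354635099535371890411685275264918742915269694096632971264,
    [⟨444, 0, 14, 3, 2, 6, 3⟩, ⟨235, 1, 14, 3, 3, 2, 6⟩, ⟨213, 2, 14, 6, 3, 3, 2⟩, ⟨130, 3, 14, 2, 6, 3, 3⟩]⟩,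
  ⟨15, 12554209457084068035049931811243708838556418237805543555072,
    1056589062271570733243201320240392290083950948291805020606006035472005773665272312279392349517188214342416717872527055626639961526703335500231355885210919651930877937262988963509144295379796248663813389984108195050684959184222909742773486398396877937481373580463274196992,
    [⟨172, 0, 15, 3, 2, 6, 4⟩, ⟨45, 1, 15, 4, 3, 2, 6⟩, ⟨193, 2, 15, 6, 4, 3, 2⟩, ⟨101, 3, 15, 2, 6, 4, 3⟩]⟩,
  ⟨16, 11101509517475918871358884916979143734462296883828953084178678008320261095706118217255606515211226447140740922141230250563884613632,
    123003273028086877138785477589627509796453805531134211995364169858111536052647634112478014179992250568839178044526613112349302144510557311519060474967021688920731275984020710836013191356914604547439937021673766291096295450199055818701344937294393055911193083904,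
    [⟨152, 0, 16, 3, 3, 6, 4⟩, ⟨16, 1, 16, 4, 3, 3, 6⟩, ⟨432, 2, 16, 6, 4, 3, 3⟩, ⟨422, 3, 16, 3, 6, 4, 3⟩]⟩,
  ⟨17, 10576920717927943275697620755202772954693629858746703661975013416985425708234777790055439146149745204025642118328946480119808,
    111870718431975236963973206599206512813344277631384334362223621164525538079383335464548056366723276872709809638958436964261027190720875376524755948937723285878152541834142024542963511078327561145496768157267592294555288697772989259002825527613456384,
    [⟨391, 0, 17, 3, 3, 6, 5⟩, ⟨337, 1, 17, 5, 3, 3, 6⟩, ⟨412, 2, 17, 6, 5, 3, 3⟩, ⟨393, 3, 17, 3, 6, 5, 3⟩]⟩,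
  ⟨18, 19701003098197239606406518429561920662839247348503917351513360855935423033075912349823227368041189684335890487312384,
    69244620785013915169893880288577664649638357106383422315705562686710368411593856553186675126003081392857398879216904074477982522716293781256725924328063374527343115739736287147529156274205944016408931499102318597919894525714263447512414134348469180429147470909462566211158016,
    [⟨201, 0, 18, 4, 3, 6, 5⟩, ⟨317, 1, 18, 5, 4, 3, 6⟩, ⟨383, 2, 18, 6, 5, 4, 3⟩, ⟨121, 3, 18, 3, 6, 5, 4⟩]⟩,
  ⟨19, 11356855067118857664833184498250070849275646261236667928308071004352871124918666457063273049977620148617581106876849578967504057794560,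
    129041134631273518774025943195097747654571315220242230441366941948653596253889191146802204261841218991219813620048034961887954800045709289595942717522285657719290022077617014859772812350664376746012931764682445337986005752834608170472010229402324777133709901082656768,
    [⟨181, 0, 19, 4, 4, 6, 5⟩, ⟨288, 1, 19, 5, 4, 4, 6⟩, ⟨111, 2, 19, 6, 5, 4, 4⟩, ⟨442, 3, 19, 4, 6, 5, 4⟩]⟩,
  ⟨20, 13093562431584567480052758787310396608866568184172259157933165472384535659903095735580216824250371225685794980130942062741192605338982759211684738367488,
    171441377149802771351748007849600289689824769887900410848609462599198483571008293321535259797610344530535212389368724599599619506458057988848057992481723180094166280471797457799937531187232214491728811844430070543936190960245538114260758939194866224145284412021360036024389485165644412910998619825373184,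
    [⟨502, 0, 20, 5, 4, 6, 5⟩, ⟨268, 1, 20, 5, 5, 4, 6⟩, ⟨82, 2, 20, 6, 5, 5, 4⟩, ⟨170, 3, 20, 4, 6, 5, 5⟩]⟩,
  ⟨21, 418993997835094819911031970501622077840513988925890463396807406327386927333214193522690635999757948726473162749818566857351920240181474295691409623089152,
    175555970201398037864784766801381809867499789349094586467636581794108556242184069909658980651324238714772755267808404872971079818770552192962288206346887678780567202892267291840698901215329259477850147848834209439891191431457906497798792825961410224820679021394291861672159778427805934232796196876928942080,
    [⟨473, 0, 21, 5, 4, 7, 5⟩, ⟨507, 1, 21, 5, 5, 4, 7⟩, ⟨403, 2, 21, 7, 5, 5, 4⟩, ⟨150, 3, 21, 4, 7, 5, 5⟩]⟩,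
  ⟨22, 399583814440447005616844445414786189812626861762392842334426799811659128554600342338381542837469366128113137817966211974517325634739424731785592832,
    159667224762777584932509817042947085285396100834836603320205369173504947872097101031727863296404100918362143999504942848682236460273755061460212434885728971471382501093525836148131115810860465298129529668138016733738025953595089697785495040595393202429287021276837370478347753549917608292122624,
    [⟨283, 0, 22, 6, 4, 7, 5⟩, ⟨487, 1, 22, 5, 6, 4, 7⟩, ⟨374, 2, 22, 7, 5, 6, 4⟩, ⟨389, 3, 22, 4, 7, 5, 6⟩]⟩,
  ⟨23, 744282853678701455922507579277316643178128753343813693728260785348397007501134494041122877478236880673304199768917278789106942331525791744,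
    558284755079174691057269409826657421237709251040540068696120954920833348594168101569817456885943823890613929957995377619067297546155276875994382166421967510728179957942759201060884079727152607139612786198545715823642113613719656347426023945797979833691717310942139789263011840,
    [⟨263, 0, 23, 6, 5, 7, 5⟩, ⟨458, 1, 23, 5, 6, 5, 7⟩, ⟨102, 2, 23, 7, 5, 6, 5⟩, ⟨199, 3, 23, 5, 7, 5, 6⟩]⟩,
  ⟨24, 709803441694928604052074031140629428079727891296209043243642772637343054798240159498233447962659731992932150015564047353956674830336,
    503820925841965910293903145710484129446837736164208910110436162020970306034554480844828205813442800296834221517021873018188690900785040420664842042829117171516357421519740905963542537565066540478687133203496925961643516911997979800699232805419357384505409251835904,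
    [⟨73, 0, 24, 7, 5, 7, 5⟩, ⟨438, 1, 24, 5, 7, 5, 7⟩, ⟨73, 2, 24, 7, 5, 7, 5⟩, ⟨438, 3, 24, 5, 7, 5, 7⟩]⟩,
  ⟨25, 1322111937580497197903830616073885779015875420938370304957605669884851721173268553673035888037586273952292191393304077664256,
    1371531017198422170813984062796802317518598158983083017529748477089542201958742625459120758288065413928966362763267014705250916867023295817406673007322486237415531557177900359114580395702391365677989657026020732603672886054795473632305786361805292184376936313942516459914147047035449172569455410313953280,
    [⟨312, 0, 25, 7, 5, 7, 6⟩, ⟨248, 1, 25, 6, 7, 5, 7⟩, ⟨53, 2, 25, 7, 6, 7, 5⟩, ⟨409, 3, 25, 5, 7, 6, 7⟩]⟩,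
  ⟨26, 7957171782556586274486958468682481899100881756979032842505974791053756345090568496349184,
    4758454107128905800953799994079681792420032645310062268978469949811010102913293995344538606387700321887355916191934096538569433505232343645960338508521288882219179402360618008472317279371338833313655394390787360039193318265195685396211663625091978277062352975687927071734736742948798464,
    [⟨292, 0, 26, 7, 6, 7, 6⟩, ⟨219, 1, 26, 6, 7, 6, 7⟩, ⟨292, 2, 26, 7, 6, 7, 6⟩, ⟨219, 3, 26, 6, 7, 6, 7⟩]⟩,
  ⟨27, 744282853678701455922507579277316643178128753343813693728260785348397007501134494041122877478236880673304199768917278789106942331525791744,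
    558284755079174691057269409826657421237709251040540068696120954920833348594168101569817456885943823890613929957995377619067297546155276875994382166421967510728179957942759201060884079727152607139612786198545715823642113613719656347426023945797979833691717310942139789263011840,
    [⟨102, 0, 27, 8, 6, 7, 6⟩, ⟨199, 1, 27, 6, 8, 6, 7⟩, ⟨263, 2, 27, 7, 6, 8, 6⟩, ⟨458, 3, 27, 6, 7, 6, 8⟩]⟩,
  ⟨28, 13093562431584567480052758787310396608866568184172259157933165472384535659903095735580216824250371225685794980130942062741192605338982759211684738367488,
    171441377149802771351748007849600289689824769887900410848609462599198483571008293321535259797610344530535212389368724599599619506458057988848057992481723180094166280471797457799937531187232214491728811844430070543936190960245538114260758939194866224145284412021360036024389485165644412910998619825373184,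
    [⟨82, 0, 28, 8, 7, 7, 6⟩, ⟨170, 1, 28, 6, 8, 7, 7⟩, ⟨502, 2, 28, 7, 6, 8, 7⟩, ⟨268, 3, 28, 7, 7, 6, 8⟩]⟩,
  ⟨29, 1322111937580497197903830616073885779015875420938370304957605669884851721173268553673035888037586273952292191393304077664256,
    1371531017198422170813984062796802317518598158983083017529748477089542201958742625459120758288065413928966362763267014705250916867023295817406673007322486237415531557177900359114580395702391365677989657026020732603672886054795473632305786361805292184376936313942516459914147047035449172569455410313953280,
    [⟨53, 0, 29, 8, 7, 8, 6⟩, ⟨409, 1, 29, 6, 8, 7, 8⟩, ⟨312, 2, 29, 8, 6, 8, 7⟩, ⟨248, 3, 29, 7, 8, 6, 8⟩]⟩,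
  ⟨30, 2462625387274654950767440006258975862817483704404090416746768337765357610718575663213391640930307515781898502668288,
    6064523798049644277925701126806650606472767942914060076656453830818116657942144281501424975967111131542744308245201071954956935656585930048491565400269294256384398020275930759582489461431117318440170084512887876467591836348710912,
    [⟨33, 0, 30, 8, 8, 8, 6⟩, ⟨380, 1, 30, 6, 8, 8, 8⟩, ⟨40, 2, 30, 8, 6, 8, 8⟩, ⟨58, 3, 30, 8, 8, 6, 8⟩]⟩,
  ⟨31, 7588550360256754183279149642804804575742092673994775806806496251131455980629393408,
    16509204097989538948510618278641143953713978938628797566498772157083559454897651858575539246489289053984764958626007344758315588412022165748109840176206317603214164510691670641129895054718280042574437497605981543124622034072869033319023175578938414004832769599562842112,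
    [⟨272, 0, 31, 8, 8, 8, 7⟩, ⟨190, 1, 31, 7, 8, 8, 8⟩, ⟨20, 2, 31, 8, 7, 8, 8⟩, ⟨29, 3, 31, 8, 8, 7, 8⟩]⟩,
  ⟨32, 2293498615990071511610820896235660660272426814770822190373058099728573933291619225303577890213237159362560,
    351111940402796075728379920075981393284761128699669252544445935098146554841456636485920921751775957271493075854013955546182331906587016124299734343477336083018881719990379579712105484102853234307964487557987312560009007219364509885170489647366280076366107802960747585161631098450883425073725551995164557440,
    [⟨252, 0, 32, 8, 9, 8, 7⟩, ⟨161, 1, 32, 7, 8, 9, 8⟩, ⟨259, 2, 32, 8, 7, 8, 9⟩, ⟨350, 3, 32, 9, 8, 7, 8⟩]⟩,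
  ⟨33, 2582249878086908589658106422727794886254078295056341147675985859546860731786774508745870643097909419219708736060281323520,
    1218164251424999885044172798484398538859528357206043955291368161425698438136524520605346646343968893223592909874519558241657253754259127169071043154245931987659310643459112622433979443336280701483074217998168574886639652508039461008140579810076518050530264666171232476308825797061213421568,
    [⟨223, 0, 33, 8, 9, 9, 7⟩, ⟨400, 1, 33, 7, 8, 9, 9⟩, ⟨69, 2, 33, 9, 7, 8, 9⟩, ⟨330, 3, 33, 9, 9, 7, 8⟩]⟩,
  ⟨34, 4809815209520810451239137472166190670150119956397052759942061890398649493090883684713143685037762803457629093888,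
    1107913932560222642718302084617242634407237173180522810887081617123177419736788643935077811991319886156601668774509515944917565728123217959082832772428844066804382525113581383613284412813794580612910711878717586561998368618829034377627782381071912208439292207927070770153390080,
    [⟨203, 0, 34, 8, 10, 9, 7⟩, ⟨371, 1, 34, 7, 8, 10, 9⟩, ⟨308, 2, 34, 9, 7, 8, 10⟩, ⟨140, 3, 34, 10, 9, 7, 8⟩]⟩,
  ⟨35, 1231312698224324707363863026352101056459028598330634917663358175811177687552659653544291342810060172138061102063616,
    1516130949512411090521968887895156680582012282611038696516840660668566918240705920359353364228039691994381393441208154300718946024845526076502711111480817618224308389569831742947350448105816500657683903427303008535270966461202432,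
    [⟨13, 0, 35, 9, 10, 9, 7⟩, ⟨351, 1, 35, 7, 9, 10, 9⟩, ⟨279, 2, 35, 9, 7, 9, 10⟩, ⟨379, 3, 35, 10, 9, 7, 9⟩]⟩,
  ⟨36, 102293456496754433437912178025862473506771238210137161587966799993302575806159767681376644545119858556450974983498809523260390691040663414720069369856,
    10463951242053391806136963369726580181263718864311851635192874886429209483641954322601553486465954871829045859821941463542010018747421210519477710107966889283200261908317557696262575646731238472153363305756808855242657774422903737645245348224677458473714320331009445570099694161882807957237264285696,
    [⟨495, 0, 36, 9, 10, 10, 7⟩, ⟨79, 1, 36, 7, 9, 10, 10⟩, ⟨89, 2, 36, 10, 7, 9, 10⟩, ⟨359, 3, 36, 10, 10, 7, 9⟩]⟩,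
  ⟨37, 97554642197374757230674913431036447054643692505093029660101636081418423617523016967051923444785522043500665494152493399677466953045790540431360,
    9516908214257811601907599988163117343254467640735110116804694528052676085623362742457416461474890276052705504864099357375525190769374622618350768771958282188039512289439491037110213636416973653777128735138471354796331144952949316126001329868827739894596823662165142562247920581565480960,
    [⟨475, 0, 37, 9, 11, 10, 7⟩, ⟨50, 1, 37, 7, 9, 11, 10⟩, ⟨328, 2, 37, 10, 7, 9, 11⟩, ⟨169, 3, 37, 11, 10, 7, 9⟩]⟩,
  ⟨38, 181709681073901722637330951972001133588410340172824161543192123079470586524643122511748675694007882321778539871082343800166415998124032,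
    33018408195979077897021239971306491508518922360227903370439583480823070457796423918667938987481541929852544759353080042329230125013804300623734379264765544900869621213519807099979347627586642744491411181454029564204919438628516771233275662612837547444753468403996426240,
    [⟨446, 0, 38, 9, 11, 11, 7⟩, ⟨289, 1, 38, 7, 9, 11, 11⟩, ⟨138, 2, 38, 11, 7, 9, 11⟩, ⟨149, 3, 38, 11, 11, 7, 9⟩]⟩,
  ⟨39, 23945242826029515073384800855668536238502372486152192,
    3843848616348006517745232740100752098062979171908983236234053348907286556510110274369804721015762672247774405696092568393150389894073556087998059109134894654088313000973951102852943200062298199137547659473305010613153046972969894537156841484744928030871257088,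
    [⟨174, 0, 39, 9, 11, 11, 8⟩, ⟨99, 1, 39, 8, 9, 11, 11⟩, ⟨118, 2, 39, 11, 8, 9, 11⟩, ⟨120, 3, 39, 11, 11, 8, 9⟩]⟩,
  ⟨40, 1419606883389857208104148062281818792345000233645057447057427656344216520970788981380191937802050809016173273920248622847972385751040,
    2015283703367863641175625918870802277495899104360427855715665622195608534705202913574078145550288313396232648223591905894499985642164106418556772722807241538357265609499542138042732431912037901188950240113674776617170950966617574694664533282394021936387078739722240,
    [⟨145, 0, 40, 9, 11, 12, 8⟩, ⟨338, 1, 40, 8, 9, 11, 12⟩, ⟨439, 2, 40, 12, 8, 9, 11⟩, ⟨100, 3, 40, 11, 12, 8, 9⟩]⟩,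
  ⟨41, 190536410541747575360385815455987456462382065892186125993555940370174031363242617709337647100167406468359670113959192256423918961801318891520,
    36304123742133375556593322708737813635749496738501135333095976466414198349068541595858329563611645632448328571707358206376464362200080601981039444367108126064771381099337424915085254759591125131502268985258722913067752636618731540221068302869029154908110974804463122240609689010176,
    [⟨466, 0, 41, 10, 11, 12, 8⟩, ⟨318, 1, 41, 8, 10, 11, 12⟩, ⟨410, 2, 41, 12, 8, 10, 11⟩, ⟨339, 3, 41, 11, 12, 8, 10⟩]⟩,
  ⟨42, 354901720847464302026037015570314715107857463608559562819332239405132581367169255914609797397789396824678259419788718056027455488000,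
    19033816428515623203815325931550187661157704057026676696946241508678081463880703590418659518626396378079980692061223581003839937691175159423185612944358161410567064704451703417422169918126615845862155076690828065716963677067007626285499605124339500925749397669818548947630451228191752192,
    [⟨437, 0, 42, 10, 11, 13, 8⟩, ⟨46, 1, 42, 8, 10, 11, 13⟩, ⟨220, 2, 42, 13, 8, 10, 11⟩, ⟨319, 3, 42, 11, 13, 8, 10⟩]⟩,
  ⟨43, 1488565707357741372501035765837296666993970285460019530654169639906223002239419442737152263270850279824751512317352026035184890958391148544,
    2215827865120445285436604283790100942688272235762780564048165946898330121796896533272557037516273337505105107051152488710758526104807156278720681973672990318497320577298706093653728690803375280376842986706832372275020736176324291642252756638761503225612694330206924283666497536,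
    [⟨417, 0, 43, 10, 12, 13, 8⟩, ⟨17, 1, 43, 8, 10, 12, 13⟩, ⟨459, 2, 43, 13, 8, 10, 12⟩, ⟨129, 3, 43, 12, 13, 8, 10⟩]⟩,
  ⟨44, 837987995621412318723379335057559503782320543428109919292732366376718405766450864704645958359963376041096079477268068703088338929281533105860737094385664,
    702223880805592463306808204951933357877758669413052150246291710598124590118446247077845309676799059943350207975519052599743033509163846768811855743573799519526120570082371522091550097960991201427812502224200467949120058955927223787686208335809505655578440093731918828067119216114539188878847596587898634240,
    [⟨227, 0, 44, 11, 12, 13, 8⟩, ⟨508, 1, 44, 8, 11, 12, 13⟩, ⟨430, 2, 44, 13, 8, 11, 12⟩, ⟨368, 3, 44, 12, 13, 8, 11⟩]⟩,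
  ⟨45, 1560874275157996115690798614896583152874299071332485575429578479812685869409882810265841121580020991441166160695688432279351446019281320100757504,
    2436328503133625736823762594488707657167055463093902514838177923154685911395479157917207735347189487122095272240471597232243715874522386625925559755995677924427020874660101981169708060412101358593365718132170886395169749664436369689854169432007354183760908889258219265476429826061307478016,
    [⟨207, 0, 45, 11, 13, 13, 8⟩, ⟨479, 1, 45, 8, 11, 13, 13⟩, ⟨158, 2, 45, 13, 8, 11, 13⟩, ⟨178, 3, 45, 13, 13, 8, 11⟩]⟩,
  ⟨46, 181709681073901722637330951972001133588410340172824161543192123079470586524643122511748675694007882321778539871082343800166415998124032,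
    33018408195979077897021239971306491508518922360227903370439583480823070457796423918667938987481541929852544759353080042329230125013804300623734379264765544900869621213519807099979347627586642744491411181454029564204919438628516771233275662612837547444753468403996426240,
    [⟨446, 0, 46, 11, 13, 13, 9⟩, ⟨289, 1, 46, 9, 11, 13, 13⟩, ⟨138, 2, 46, 13, 9, 11, 13⟩, ⟨149, 3, 46, 13, 13, 9, 11⟩]⟩,
  ⟨47, 630432099142311667396464641602297821829960415448778735792489774644111577385796354148870438360751489483304631026057216,
    397444631628984311412097457263897603254605025009737683805509173312193728189426117910982440363338205340467224268248076778394569987834462853435563276863094194830092672966226909539587765768847478620010715887106258089746238732328807432194,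
    [⟨256, 0, 47, 12, 13, 13, 9⟩, ⟨269, 1, 47, 9, 12, 13, 13⟩, ⟨109, 2, 47, 13, 9, 12, 13⟩, ⟨388, 3, 47, 13, 13, 9, 12⟩]⟩,
  ⟨48, 573374653997517877902705223825523612474147574727154974252739318083144308809052282993198390929818503872512,
    21009652103185325735759372847726349036035985061843019120311704258507970888351738728643365129897284370317059328212105761464591947610581232899342007546045147400113514564886938644401220903400177323048804286915125286057629327635899411244942598080074070067811679649788285331619354281315887916247060316160,
    [⟨236, 0, 48, 12, 14, 13, 9⟩, ⟨240, 1, 48, 9, 12, 14, 13⟩, ⟨348, 2, 48, 13, 9, 12, 14⟩, ⟨198, 3, 48, 14, 13, 9, 12⟩]⟩,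
  ⟨49, 354901720847464302026037015570314715107857463608559562819332239405132581367169255914609797397789396824678259419788718056027455488000,
    19033816428515623203815325931550187661157704057026676696946241508678081463880703590418659518626396378079980692061223581003839937691175159423185612944358161410567064704451703417422169918126615845862155076690828065716963677067007626285499605124339500925749397669818548947630451228191752192,
    [⟨46, 0, 49, 13, 14, 13, 9⟩, ⟨220, 1, 49, 9, 13, 14, 13⟩, ⟨319, 2, 49, 13, 9, 13, 14⟩, ⟨437, 3, 49, 14, 13, 9, 13⟩]⟩,
  ⟨50, 1488565707357741372501035765837296666993970285460019530654169639906223002239419442737152263270850279824751512317352026035184890958391148544,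
    2215827865120445285436604283790100942688272235762780564048165946898330121796896533272557037516273337505105107051152488710758526104807156278720681973672990318497320577298706093653728690803375280376842986706832372275020736176324291642252756638761503225612694330206924283666497536,
    [⟨17, 0, 50, 13, 14, 14, 9⟩, ⟨459, 1, 50, 9, 13, 14, 14⟩, ⟨129, 2, 50, 14, 9, 13, 14⟩, ⟨417, 3, 50, 14, 14, 9, 13⟩]⟩,
  ⟨51, 1419606883389857208104148062281818792345000233645057447057427656344216520970788981380191937802050809016173273920248622847972385751040,
    2015283703367863641175625918870802277495899104360427855715665622195608534705202913574078145550288313396232648223591905894499985642164106418556772722807241538357265609499542138042732431912037901188950240113674776617170950966617574694664533282394021936387078739722240,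
    [⟨338, 0, 51, 14, 14, 14, 9⟩, ⟨439, 1, 51, 9, 14, 14, 14⟩, ⟨100, 2, 51, 14, 9, 14, 14⟩, ⟨145, 3, 51, 14, 14, 9, 14⟩]⟩,
  ⟨52, 904625697166532776746648320380374280103754831950054672799925453927101759488,
    5486124068793688683255936251187209270074392635932332070112001988456197381759672993433820399011798263637281762676309234708413938190923464370728133137010947736293683678449976229508586604780593112352090897907129394245379582748513979422027175767513437847514941427016802773775441887965904548819542765299826688,
    [⟨66, 0, 52, 14, 14, 14, 10⟩, ⟨249, 1, 52, 10, 14, 14, 14⟩, ⟨80, 2, 52, 14, 10, 14, 14⟩, ⟨116, 3, 52, 14, 14, 10, 14⟩]⟩,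
  ⟨53, 799167628880894011233688895991550330445458303834070958625967930323506750796307024412117075465549188650598083626370802100738507159968482714888175616,
    638668899051110339730039268171788341141584403339346439952872849099324901717475663978298824749063701670150143638213874985256015403629148372128876448277527653854146776680889884342781164215429809546095444395883817217780308278617215319513752935036098170651727320457770231334484951897349477252464640,
    [⟨37, 0, 53, 14, 14, 15, 10⟩, ⟨488, 1, 53, 10, 14, 14, 15⟩, ⟨401, 2, 53, 15, 10, 14, 14⟩, ⟨96, 3, 53, 14, 15, 10, 14⟩]⟩,
  ⟨54, 1488565707357741372501035765837296666993970285460019530654169639906223002239419442737152263270850279824751512317352026035184890958391148544,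
    2215827865120445285436604283790100942688272235762780564048165946898330121796896533272557037516273337505105107051152488710758526104807156278720681973672990318497320577298706093653728690803375280376842986706832372275020736176324291642252756638761503225612694330206924283666497536,
    [⟨17, 0, 54, 14, 15, 15, 10⟩, ⟨459, 1, 54, 10, 14, 15, 15⟩, ⟨129, 2, 54, 15, 10, 14, 15⟩, ⟨417, 3, 54, 15, 15, 10, 14⟩]⟩,
  ⟨55, 1636695303948073842361492030841684554638313438613376799203588809804599237387237652937891332174409123721629136041240852643330310142087117169206872768512,
    2678771517965668302371062622658457496857996704292017525646450944585778975557562199159689524946634462577359549007348839591499413428738693025871306276247263015076561499449597494864238643902057917953599316344443229388173955712261984545131304080621026985691528430557750273921496248872591074905614888992768,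
    [⟨499, 0, 55, 14, 15, 16, 10⟩, ⟨187, 1, 55, 10, 14, 15, 16⟩, ⟨450, 2, 55, 16, 10, 14, 15⟩, ⟨397, 3, 55, 15, 16, 10, 14⟩]⟩,
  ⟨56, 837987995621412318723379335057559503782320543428109919292732366376718405766450864704645958359963376041096079477268068703088338929281533105860737094385664,
    702223880805592463306808204951933357877758669413052150246291710598124590118446247077845309676799059943350207975519052599743033509163846768811855743573799519526120570082371522091550097960991201427812502224200467949120058955927223787686208335809505655578440093731918828067119216114539188878847596587898634240,
    [⟨227, 0, 56, 14, 15, 16, 11⟩, ⟨508, 1, 56, 11, 14, 15, 16⟩, ⟨430, 2, 56, 16, 11, 14, 15⟩, ⟨368, 3, 56, 15, 16, 11, 14⟩]⟩,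
  ⟨57, 573374653997517877902705223825523612474147574727154974252739318083144308809052282993198390929818503872512,
    21009652103185325735759372847726349036035985061843019120311704258507970888351738728643365129897284370317059328212105761464591947610581232899342007546045147400113514564886938644401220903400177323048804286915125286057629327635899411244942598080074070067811679649788285331619354281315887916247060316160,
    [⟨198, 0, 57, 14, 15, 17, 11⟩, ⟨236, 1, 57, 11, 14, 15, 17⟩, ⟨240, 2, 57, 17, 11, 14, 15⟩, ⟨348, 3, 57, 15, 17, 11, 14⟩]⟩,
  ⟨58, 108603300783199598782227966048785133328860642689679996895331614976,
    74423453671373419891016311552912503619850669272503873072859675576115194022920629047098698422278585651584733786580666978195288865221221483919712571035428776824259072659082390110542188714529516606983228850211253765503593385684482539746593126962843391546036863836132893842066209014611968,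
    [⟨8, 0, 58, 15, 15, 17, 11⟩, ⟨216, 1, 58, 11, 15, 15, 17⟩, ⟨211, 2, 58, 17, 11, 15, 15⟩, ⟨76, 3, 58, 15, 17, 11, 15⟩]⟩,
  ⟨59, 3196670515616611401644593245298515744496229078486196552647753438372411406046561823881708383722768232959024513860097984610540797871155690756143841280,
    10218702384817765435689283868346740197661587188465614820574246675868300701387640525075677808541784169675062214971388448255253807538481510405761620476234938918906995719172765332535647327715409591732539340604754657522615838153992753677081030244204805374834248405420990052907086866873725707773542400,
    [⟨490, 0, 59, 15, 15, 18, 11⟩, ⟨455, 1, 59, 11, 15, 15, 18⟩, ⟨21, 2, 59, 18, 11, 15, 15⟩, ⟨56, 3, 59, 15, 18, 11, 15⟩]⟩,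
  ⟨60, 59285549689506313306035018553195000492984966830537244368583885208496539753775106,
    1189613526782226450238449998519920448105008161327515567244617487452752525728323498836134651596925080471838979032154499207161266000562413898711315354418782399226029356389659355787819169718729984076984364393393426460248452550332943304693842523921361832872239903842387684174372861479747588,
    [⟨218, 0, 60, 15, 15, 18, 12⟩, ⟨265, 1, 60, 12, 15, 15, 18⟩, ⟨1, 2, 60, 18, 12, 15, 15⟩, ⟨27, 3, 60, 15, 18, 12, 15⟩]⟩,
  ⟨61, 573374653997517877902705223825523612474147574727154974252739318083144308809052282993198390929818503872512,
    21009652103185325735759372847726349036035985061843019120311704258507970888351738728643365129897284370317059328212105761464591947610581232899342007546045147400113514564886938644401220903400177323048804286915125286057629327635899411244942598080074070067811679649788285331619354281315887916247060316160,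
    [⟨198, 0, 61, 15, 16, 18, 12⟩, ⟨236, 1, 61, 12, 15, 16, 18⟩, ⟨240, 2, 61, 18, 12, 15, 16⟩, ⟨348, 3, 61, 16, 18, 12, 15⟩]⟩,
  ⟨62, 97554642197374757230674913431036447054643692505093029660101636081418423617523016967051923444785522043500665494152493399677466953045790540431360,
    9516908214257811601907599988163117343254467640735110116804694528052676085623362742457416461474890276052705504864099357375525190769374622618350768771958282188039512289439491037110213636416973653777128735138471354796331144952949316126001329868827739894596823662165142562247920581565480960,
    [⟨169, 0, 62, 15, 16, 19, 12⟩, ⟨475, 1, 62, 12, 15, 16, 19⟩, ⟨50, 2, 62, 19, 12, 15, 16⟩, ⟨328, 3, 62, 16, 19, 12, 15⟩]⟩,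
  ⟨63, 181709681073901722637330951972001133588410340172824161543192123079470586524643122511748675694007882321778539871082343800166415998124032,
    33018408195979077897021239971306491508518922360227903370439583480823070457796423918667938987481541929852544759353080042329230125013804300623734379264765544900869621213519807099979347627586642744491411181454029564204919438628516771233275662612837547444753468403996426240,
    [⟨149, 0, 63, 15, 17, 19, 12⟩, ⟨446, 1, 63, 12, 15, 17, 19⟩, ⟨289, 2, 63, 19, 12, 15, 17⟩, ⟨138, 3, 63, 17, 19, 12, 15⟩]⟩,
  ⟨64, 3048582568668134455314473595956440794753456185273655667610478441624959134512536206100956082734057603478291708698802721869630749042956132417536,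
    9293855677986144142487890643466945816039177180255846151230359750316193173293130561475253444377631738606326607623064407504467646078944937981413051982178947261104194901774864179430082802188263801722706521609109895653345388411428896892067578581158085049127265370048777409152124928918016,
    [⟨470, 0, 64, 16, 17, 19, 12⟩, ⟨426, 1, 64, 12, 16, 17, 19⟩, ⟨260, 2, 64, 19, 12, 16, 17⟩, ⟨377, 3, 64, 17, 19, 12, 16⟩]⟩,
  ⟨65, 5678427533559428832416592542692858271366976616554746944616270603059063051925905114397261861190489290627609565588021096744726489464832,
    32244539253885818262305761276456697322246392450163123237083956389145741898201435500178357800027097522178036288184510724485323225184728678855668805369308307398380343532619284388955533421707904362834667113318820973539363623537811431129086906832536542987195783432896512,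
    [⟨441, 0, 65, 16, 17, 20, 12⟩, ⟨154, 1, 65, 12, 16, 17, 20⟩, ⟨70, 2, 65, 20, 12, 16, 17⟩, ⟨357, 3, 65, 17, 20, 12, 16⟩]⟩,
  ⟨66, 5415370496329716522614090203404461401236711046100267917824035396489550700159867174168888735734883619690588304885726805464449024,
    263936138512665242459923524861794907629780104062126987324633613400921862368133927995388303149009862426025172703654975355384962918517618737498405808607658104604786318452095279045548220663253107781850937946202235306948662873130301237360677495015098197999616,
    [⟨421, 0, 66, 16, 18, 20, 12⟩, ⟨125, 1, 66, 12, 16, 18, 20⟩, ⟨309, 2, 66, 20, 12, 16, 18⟩, ⟨167, 3, 66, 18, 20, 12, 16⟩]⟩,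
  ⟨67, 10086913623853668002724765911868454682729805691250075129527881042803560318197036280608646239694466060835886436217520128,
    213376563597981036751010704000007229576856955507372047647950312735999235996624666300326930220076397134500941620608569580205140954253878591580606547451130055896528833364508071507876831984090423515813911565609935826363368889470516718975590596608,
    [⟨392, 0, 67, 16, 18, 21, 12⟩, ⟨364, 1, 67, 12, 16, 18, 21⟩, ⟨119, 2, 67, 21, 12, 16, 18⟩, ⟨147, 3, 67, 18, 21, 12, 16⟩]⟩,
  ⟨68, 23945242826029515073384800855668536238502372486152192,
    3843848616348006517745232740100752098062979171908983236234053348907286556510110274369804721015762672247774405696092568393150389894073556087998059109134894654088313000973951102852943200062298199137547659473305010613153046972969894537156841484744928030871257088,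
    [⟨120, 0, 68, 16, 18, 21, 13⟩, ⟨174, 1, 68, 13, 16, 18, 21⟩, ⟨99, 2, 68, 21, 13, 16, 18⟩, ⟨118, 3, 68, 18, 21, 13, 16⟩]⟩,
  ⟨69, 2728839039166146216473506391559278852411654531276552873207030226892747106223493235566381060695145015239386658867407347054018560,
    7332006886003316239600027730519722322976856093740462136638378518468473112215622747026673617927819931214194471042615457000846230884423459697241700150990467923859570693174569081150805069813506692495212200440758743695826308851982458472336584711226030817280,
    [⟨91, 0, 69, 16, 18, 22, 13⟩, ⟨413, 1, 69, 13, 16, 18, 22⟩, ⟨420, 2, 69, 22, 13, 16, 18⟩, ⟨98, 3, 69, 18, 22, 13, 16⟩]⟩,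
  ⟨70, 10576920717927943275697620755202772954693629858746703661975013416985425708234777790055439146149745204025642118328946480119808,
    111870718431975236963973206599206512813344277631384334362223621164525538079383335464548056366723276872709809638958436964261027190720875376524755948937723285878152541834142024542963511078327561145496768157267592294555288697772989259002825527613456384,
    [⟨412, 0, 70, 17, 18, 22, 13⟩, ⟨393, 1, 70, 13, 17, 18, 22⟩, ⟨391, 2, 70, 22, 13, 17, 18⟩, ⟨337, 3, 70, 18, 22, 13, 17⟩]⟩,
  ⟨71, 19701003098197239606406518429561920662839247348503917351513360855935423033075912349823227368041189684335890487312384,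
    69244620785013915169893880288577664649638357106383422315705562686710368411593856553186675126003081392857398879216904074477982522716293781256725924328063374527343115739736287147529156274205944016408931499102318597919894525714263447512414134348469180429147470909462566211158016,
    [⟨383, 0, 71, 17, 18, 23, 13⟩, ⟨121, 1, 71, 13, 17, 18, 23⟩, ⟨201, 2, 71, 23, 13, 17, 18⟩, ⟨317, 3, 71, 18, 23, 13, 17⟩]⟩,
  ⟨72, 11356855067118857664833184498250070849275646261236667928308071004352871124918666457063273049977620148617581106876849578967504057794560,
    129041134631273518774025943195097747654571315220242230441366941948653596253889191146802204261841218991219813620048034961887954800045709289595942717522285657719290022077617014859772812350664376746012931764682445337986005752834608170472010229402324777133709901082656768,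
    [⟨111, 0, 72, 17, 18, 23, 14⟩, ⟨442, 1, 72, 14, 17, 18, 23⟩, ⟨181, 2, 72, 23, 14, 17, 18⟩, ⟨288, 3, 72, 18, 23, 14, 17⟩]⟩,
  ⟨73, 13093562431584567480052758787310396608866568184172259157933165472384535659903095735580216824250371225685794980130942062741192605338982759211684738367488,
    171441377149802771351748007849600289689824769887900410848609462599198483571008293321535259797610344530535212389368724599599619506458057988848057992481723180094166280471797457799937531187232214491728811844430070543936190960245538114260758939194866224145284412021360036024389485165644412910998619825373184,
    [⟨82, 0, 73, 17, 18, 24, 14⟩, ⟨170, 1, 73, 14, 17, 18, 24⟩, ⟨502, 2, 73, 24, 14, 17, 18⟩, ⟨268, 3, 73, 18, 24, 14, 17⟩]⟩,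
  ⟨74, 1725436586697640946858688968356849512929105136036797489461351965261824,
    19958403095347198116563727130368385660674512604354575467119335181245980434938482772859406195732141817961201045456864007604006863577599572099227423297560655267111209929435001115784601675937793838817196060257893975633204732744161577880531509256690740034749707564434913855157402081823271596064768,
    [⟨62, 0, 74, 17, 19, 24, 14⟩, ⟨141, 1, 74, 14, 17, 19, 24⟩, ⟨230, 2, 74, 24, 14, 17, 19⟩, ⟨78, 3, 74, 19, 24, 14, 17⟩]⟩,
  ⟨75, 11908525658859223294760121268437066290850060053505093171604604395548130987828375836655738317723789099831362785400756557728191729308891348992,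
    18293874854434396276564604021199910379117256738096416971034485802817949750298706454022094017982882659689847096300909752221931073974795100200978327881342464499213790159921413031764519347802732505146196724692162707197896094993332175109258135664482568339505994253350579961050106429440,
    [⟨301, 0, 75, 17, 19, 24, 15⟩, ⟨462, 1, 75, 15, 17, 19, 24⟩, ⟨210, 2, 75, 24, 15, 17, 19⟩, ⟨49, 3, 75, 19, 24, 15, 17⟩]⟩,
  ⟨76, 7588550360256754183279149642804804575742092673994775806806496251131455980629393408,
    16509204097989538948510618278641143953713978938628797566498772157083559454897651858575539246489289053984764958626007344758315588412022165748109840176206317603214164510691670641129895054718280042574437497605981543124622034072869033319023175578938414004832769599562842112,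
    [⟨272, 0, 76, 17, 19, 25, 15⟩, ⟨190, 1, 76, 15, 17, 19, 25⟩, ⟨20, 2, 76, 25, 15, 17, 19⟩, ⟨29, 3, 76, 19, 25, 15, 17⟩]⟩,
  ⟨77, 1,
    6703903964971298549787012499102923063739682910296196688861780721860882015036773488400937149083451713845015929093243025426876941405973284973216824503042049,
    [⟨0, 0, 77, 17, 19, 25, 16⟩, ⟨0, 1, 77, 16, 17, 19, 25⟩, ⟨0, 2, 77, 25, 16, 17, 19⟩, ⟨0, 3, 77, 19, 25, 16, 17⟩]⟩,
  ⟨78, 6405828025248416058795037515535577259396123388748525073537061922971427598102454815123486521060121886875876216002255776569348616854060410473327624192,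
    5272850586490991147211189483680402750467933807989273709566530040626222156773632596941413787644145165534137994533958185518368918992066321972729110416601453593230926845228130202214603560610156396393589145653305036571208825163417914303996131002298146845881938093379984764113603998895156670735809773568,
    [⟨321, 0, 78, 18, 19, 25, 16⟩, ⟨491, 1, 78, 16, 18, 19, 25⟩, ⟨482, 2, 78, 25, 16, 18, 19⟩, ⟨239, 3, 78, 19, 25, 16, 18⟩]⟩,
  ⟨79, 11908525658859223294760121268437066290850060053505093171604604395548130987828375836655738317723789099831362785400756557728191729308891348992,
    18293874854434396276564604021199910379117256738096416971034485802817949750298706454022094017982882659689847096300909752221931073974795100200978327881342464499213790159921413031764519347802732505146196724692162707197896094993332175109258135664482568339505994253350579961050106429440,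
    [⟨49, 0, 79, 18, 19, 25, 17⟩, ⟨301, 1, 79, 17, 18, 19, 25⟩, ⟨462, 2, 79, 25, 17, 18, 19⟩, ⟨210, 3, 79, 19, 25, 17, 18⟩]⟩,
  ⟨80, 7588550360256754183279149642804804575742092673994775806806496251131455980629393408,
    16509204097989538948510618278641143953713978938628797566498772157083559454897651858575539246489289053984764958626007344758315588412022165748109840176206317603214164510691670641129895054718280042574437497605981543124622034072869033319023175578938414004832769599562842112,
    [⟨29, 0, 80, 18, 20, 25, 17⟩, ⟨272, 1, 80, 17, 18, 20, 25⟩, ⟨190, 2, 80, 25, 17, 18, 20⟩, ⟨20, 3, 80, 20, 25, 17, 18⟩]⟩,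
  ⟨81, 13093562431584567480052758787310396608866568184172259157933165472384535659903095735580216824250371225685794980130942062741192605338982759211684738367488,
    171441377149802771351748007849600289689824769887900410848609462599198483571008293321535259797610344530535212389368724599599619506458057988848057992481723180094166280471797457799937531187232214491728811844430070543936190960245538114260758939194866224145284412021360036024389485165644412910998619825373184,
    [⟨268, 0, 81, 18, 20, 25, 18⟩, ⟨82, 1, 81, 18, 18, 20, 25⟩, ⟨170, 2, 81, 25, 18, 18, 20⟩, ⟨502, 3, 81, 20, 25, 18, 18⟩]⟩,
  ⟨82, 6405828025248416058795037515535577259396123388748525073537061922971427598102454815123486521060121886875876216002255776569348616854060410473327624192,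
    5272850586490991147211189483680402750467933807989273709566530040626222156773632596941413787644145165534137994533958185518368918992066321972729110416601453593230926845228130202214603560610156396393589145653305036571208825163417914303996131002298146845881938093379984764113603998895156670735809773568,
    [⟨239, 0, 82, 18, 20, 26, 18⟩, ⟨321, 1, 82, 18, 18, 20, 26⟩, ⟨491, 2, 82, 26, 18, 18, 20⟩, ⟨482, 3, 82, 20, 26, 18, 18⟩]⟩,
  ⟨83, 7957171782556586274486958468682481899100881756979032842505974791053756345090568496349184,
    4758454107128905800953799994079681792420032645310062268978469949811010102913293995344538606387700321887355916191934096538569433505232343645960338508521288882219179402360618008472317279371338833313655394390787360039193318265195685396211663625091978277062352975687927071734736742948798464,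
    [⟨219, 0, 83, 18, 21, 26, 18⟩, ⟨292, 1, 83, 18, 18, 21, 26⟩, ⟨219, 2, 83, 26, 18, 18, 21⟩, ⟨292, 3, 83, 21, 26, 18, 18⟩]⟩,
  ⟨84, 7588550360256754183279149642804804575742092673994775806806496251131455980629393408,
    16509204097989538948510618278641143953713978938628797566498772157083559454897651858575539246489289053984764958626007344758315588412022165748109840176206317603214164510691670641129895054718280042574437497605981543124622034072869033319023175578938414004832769599562842112,
    [⟨190, 0, 84, 18, 21, 27, 18⟩, ⟨20, 1, 84, 18, 18, 21, 27⟩, ⟨29, 2, 84, 27, 18, 18, 21⟩, ⟨272, 3, 84, 21, 27, 18, 18⟩]⟩]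

theorem kerT_eq : kerT.map (fun R => (R.r, R.l)) = (List.range 85).map
    (fun r => (r, (List.range 4).map (fun a => kerMk a r))) := by
  rfl

theorem kerT_mask : ∀ R ∈ kerT, ∀ e ∈ R.l, R.A.testBit e.g = true ∧
    R.D.testBit ((e.g + e.g) % 511) = true ∧ R.D.testBit ((e.g + e.g) % 511 + 511) = true := by
  decide +kernel

def kerBody (R₀ R₁ R₂ : KerR) : Bool :=
  match R₂ with
  | ⟨_, A, _, l⟩ =>
    kerAll R₀.l fun e₀ =>
      Bool.rec (kerAll R₁.l fun e₁ => kerAll l fun e₂ => kerTst e₀ e₁ e₂) true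
        (Nat.beq (Nat.land (Nat.shiftLeft A e₀.g) R₁.D) 0)

def kerChk : Bool :=
  kerAll kerT fun R₀ => kerAll kerT fun R₁ =>
    Nat.rec true (fun k _ => kerBody R₀ R₁ (kerT.getD k ⟨0, 0, 0, []⟩))
      (Nat.add (Nat.mod (Nat.sub (Nat.add 85 (Nat.add R₁.r R₁.r)) R₀.r) 85) 1)

theorem kerChk_true : kerChk = true := by
  decide +kernel

theorem kerT_get (r : ℕ) (hr : r < 85) : ∃ A D, kerT.getD r ⟨0, 0, 0, []⟩ ∈ kerT ∧
    kerT.getD r ⟨0, 0, 0, []⟩ = ⟨r, A, D, (List.range 4).map (fun a => kerMk a r)⟩ := by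
  have hl : r < kerT.length := hr
  have h1 : (kerT.map (fun R => (R.r, R.l)))[r]? = some (kerT[r].r, kerT[r].l) := by
    simp [hl]
  rw [kerT_eq] at h1
  have h2 : ((List.range 85).map (fun r => (r, (List.range 4).map (fun a => kerMk a r))))[r]?
      = some (r, (List.range 4).map (fun a => kerMk a r)) := by
    rw [List.getElem?_map, List.getElem?_range hr]; rfl
  rw [h2] at h1
  have h3 := Option.some.inj h1
  have hr' : kerT[r].r = r := (congrArg Prod.fst h3).symm
  have hl' : kerT[r].l = (List.range 4).map (fun a => kerMk a r) := (congrArg Prod.snd h3).symm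
  rw [List.getD_eq_getElem _ _ hl]
  refine ⟨kerT[r].A, kerT[r].D, List.getElem_mem hl, ?_⟩
  generalize kerT[r] = R at *
  cases R
  simp only at hr' hl'
  rw [hr', hl']

theorem kerChk_sound {a₀ r₀ a₁ r₁ a₂ r₂ : ℕ} (ha₀ : a₀ < 4) (ha₁ : a₁ < 4) (ha₂ : a₂ < 4)
    (hr₀ : r₀ < 85) (hr₁ : r₁ < 85) (hr₂ : r₂ < 85)
    (hr : r₂ = (85 + (r₁ + r₁) - r₀) % 85)
    (hg : ((kerMk a₀ r₀).g + (kerMk a₂ r₂).g) % 511 = ((kerMk a₁ r₁).g + (kerMk a₁ r₁).g) % 511) :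
    kerGood (kerMk a₀ r₀) (kerMk a₁ r₁) (kerMk a₂ r₂) := by
  have hm : ∀ a < 4, ∀ r, kerMk a r ∈ (List.range 4).map (fun a => kerMk a r) := by
    intro a ha r
    exact List.mem_map.2 ⟨a, List.mem_range.2 ha, rfl⟩
  obtain ⟨A₀, D₀, hT₀, hE₀⟩ := kerT_get r₀ hr₀
  obtain ⟨A₁, D₁, hT₁, hE₁⟩ := kerT_get r₁ hr₁
  obtain ⟨A₂, D₂, hT₂, hE₂⟩ := kerT_get r₂ hr₂
  have h1 := kerAll_mem (kerAll_mem kerChk_true _ hT₀) _ hT₁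
  rw [hE₁] at hT₁ h1
  rw [hE₂] at hT₂
  rw [hE₀] at h1
  have hidx : Nat.mod (Nat.sub (Nat.add 85 (Nat.add r₁ r₁)) r₀) 85 = r₂ := hr.symm
  dsimp only at h1
  rw [hidx] at h1
  change kerBody _ _ (kerT.getD r₂ ⟨0, 0, 0, []⟩) = true at h1
  rw [hE₂] at h1
  unfold kerBody at h1
  dsimp only at h1
  have h2 := kerAll_mem h1 _ (hm a₀ ha₀ r₀)
  have hmask : Nat.beq (Nat.land (Nat.shiftLeft A₂ (kerMk a₀ r₀).g) D₁) 0 = false := by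
    have k1 := (kerT_mask _ hT₂ _ (hm a₂ ha₂ r₂)).1
    have k2 := (kerT_mask _ hT₁ _ (hm a₁ ha₁ r₁)).2
    dsimp only at k1 k2
    have hlt0 : (kerMk a₀ r₀).g < 511 := Nat.mod_lt _ (by norm_num)
    have hlt2 : (kerMk a₂ r₂).g < 511 := Nat.mod_lt _ (by norm_num)
    have k3 : D₁.testBit ((kerMk a₀ r₀).g + (kerMk a₂ r₂).g) = true := by
      rcases lt_or_ge ((kerMk a₀ r₀).g + (kerMk a₂ r₂).g) 511 with hlt | hge
      · have e : (kerMk a₀ r₀).g + (kerMk a₂ r₂).g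
          = ((kerMk a₁ r₁).g + (kerMk a₁ r₁).g) % 511 := by omega
        rw [e]; exact k2.1
      · have e : (kerMk a₀ r₀).g + (kerMk a₂ r₂).g
          = ((kerMk a₁ r₁).g + (kerMk a₁ r₁).g) % 511 + 511 := by omega
        rw [e]; exact k2.2
    have k4 : ((A₂ <<< (kerMk a₀ r₀).g) &&& D₁).testBit
        ((kerMk a₀ r₀).g + (kerMk a₂ r₂).g) = true := by
      rw [Nat.testBit_land, Nat.testBit_shiftLeft, k3]
      simp [k1]
    rw [Bool.eq_false_iff]
    intro hz
    have hz' : (A₂ <<< (kerMk a₀ r₀).g) &&& D₁ = 0 := Nat.eq_of_beq_eq_true hz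
    rw [hz'] at k4
    simp at k4
  rw [hmask] at h2
  have h3 := kerAll_mem (kerAll_mem h2 _ (hm a₁ ha₁ r₁)) _ (hm a₂ ha₂ r₂)
  have hb : Nat.beq (Nat.mod (Nat.add (kerMk a₀ r₀).g (kerMk a₂ r₂).g) 511)
      (Nat.mod (Nat.add (kerMk a₁ r₁).g (kerMk a₁ r₁).g) 511) = true := by
    rw [Nat.beq_eq]; exact hg
  unfold kerTst at h3
  rw [hb] at h3
  exact of_decide_eq_true h3

/-- The word of Keränen: sum of the block letters at the base `85` digits. -/
def kerW (n : ℕ) : ℕ :=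
  if h : n = 0 then 0 else (kerW (n / 85) + kerC.getD (n % 85) 0) % 4
termination_by n
decreasing_by omega

theorem kerW_lt (n : ℕ) : kerW n < 4 := by
  rw [kerW]; split <;> omega

theorem kerW_block (q r : ℕ) (hr : r < 85) :
    kerW (85 * q + r) = (kerW q + kerC.getD r 0) % 4 := by
  by_cases h : 85 * q + r = 0
  · have hq : q = 0 := by omega
    have hr : r = 0 := by omega
    subst hq hr
    simp [kerW, kerC]
  · rw [kerW, dif_neg h]
    have h1 : (85 * q + r) / 85 = q := by omega
    have h2 : (85 * q + r) % 85 = r := by omega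
    rw [h1, h2]

theorem kerC_step : ∀ r < 84, kerC.getD r 0 % 4 ≠ kerC.getD (r + 1) 0 % 4 := by decide

theorem kerW_succ_ne (n : ℕ) : kerW n ≠ kerW (n + 1) := by
  induction n using Nat.strong_induction_on with
  | _ n ih =>
    have hn : n = 85 * (n / 85) + n % 85 := by omega
    have hlt : n % 85 < 85 := by omega
    generalize n / 85 = q at *
    generalize n % 85 = r at *
    by_cases hr : r < 84
    · have e1 := kerW_block q r hlt
      have e2 := kerW_block q (r + 1) (by omega)
      have := kerC_step r hr
      have e3 : n + 1 = 85 * q + (r + 1) := by omega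
      rw [e3, hn, e1, e2]
      omega
    · have hr : r = 84 := by omega
      subst hr
      have e1 := kerW_block q 84 (by omega)
      have e2 := kerW_block (q + 1) 0 (by omega)
      have e3 : n + 1 = 85 * (q + 1) + 0 := by omega
      have c1 : kerC.getD 84 0 = 0 := by decide
      have c2 : kerC.getD 0 0 = 0 := by decide
      rw [e3, e2, hn, e1, c1, c2]
      have := ih q (by omega)
      have := kerW_lt q
      have := kerW_lt (q + 1)
      omega

/-- Number of letters `b` among the first `n`. -/
def kerP (b n : ℕ) : ℕ := ∑ k ∈ Finset.range n, if kerW k = b then 1 else 0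

theorem kerP_succ (b n : ℕ) : kerP b (n + 1) = kerP b n + if kerW n = b then 1 else 0 := by
  unfold kerP; rw [Finset.sum_range_succ]

theorem kerP_sum (n : ℕ) : kerP 0 n + kerP 1 n + kerP 2 n + kerP 3 n = n := by
  induction n with
  | zero => simp [kerP]
  | succ n ih =>
    simp only [kerP_succ]
    have := kerW_lt n
    split_ifs <;> omega

theorem kerV_succ (a r b : ℕ) (hr : r < 85) :
    kerV a (r + 1) b = kerV a r b + if (a + kerC.getD r 0) % 4 = b then 1 else 0 := by
  have hl : r < kerC.length := hr
  unfold kerV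
  rw [List.take_succ_eq_append_getElem hl, List.countP_append]
  congr 1
  have : kerC.getD r 0 = kerC[r] := by simp [List.getD, hl]
  rw [this, List.countP_singleton]
  have e : (Nat.beq (Nat.mod (Nat.add a kerC[r]) 4) b = true) ↔ ((a + kerC[r]) % 4 = b) := by
    rw [Nat.beq_eq]; rfl
  simp only [e]

theorem kerP_block (b q r : ℕ) (hr : r ≤ 85) :
    kerP b (85 * q + r) = kerP b (85 * q) + kerV (kerW q) r b := by
  induction r with
  | zero => simp [kerV]
  | succ r ih =>
    rw [← add_assoc, kerP_succ, ih (by omega), kerV_succ _ _ _ (by omega), kerW_block _ _ (by omega)]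
    omega

theorem kerV_full : ∀ a < 4, ∀ b < 4, kerV a 85 b = kerM a b := by decide

theorem kerP_mul (b q : ℕ) (hb : b < 4) :
    kerP b (85 * q) = kerP 0 q * kerM 0 b + kerP 1 q * kerM 1 b + kerP 2 q * kerM 2 b
      + kerP 3 q * kerM 3 b := by
  induction q with
  | zero => simp [kerP]
  | succ q ih =>
    have : 85 * (q + 1) = 85 * q + 85 := by ring
    rw [this, kerP_block _ _ _ le_rfl, ih, kerV_full _ (kerW_lt q) _ hb]
    simp only [kerP_succ]
    have := kerW_lt q
    generalize kerW q = a at *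
    interval_cases a <;> simp <;> ring

theorem kerV_sum (a r : ℕ) (hr : r ≤ 85) :
    kerV a r 0 + kerV a r 1 + kerV a r 2 + kerV a r 3 = r := by
  induction r with
  | zero => simp [kerV]
  | succ r ih =>
    simp only [kerV_succ _ _ _ (show r < 85 by omega)]
    have := ih (by omega)
    split_ifs <;> omega

/-- Injectivity of the incidence matrix. -/
theorem kerM_inj (a b c d : ℤ)
    (h0 : 19 * a + 18 * b + 27 * c + 21 * d = 0) (h1 : 21 * a + 19 * b + 18 * c + 27 * d = 0)
    (h2 : 27 * a + 21 * b + 19 * c + 18 * d = 0) (h3 : 18 * a + 27 * b + 21 * c + 19 * d = 0) :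
    a = 0 ∧ b = 0 ∧ c = 0 ∧ d = 0 := by
  refine ⟨?_, ?_, ?_, ?_⟩ <;> linarith

theorem kerM_vals :
    kerM 0 0 = 19 ∧ kerM 0 1 = 21 ∧ kerM 0 2 = 27 ∧ kerM 0 3 = 18 ∧
    kerM 1 0 = 18 ∧ kerM 1 1 = 19 ∧ kerM 1 2 = 21 ∧ kerM 1 3 = 27 ∧
    kerM 2 0 = 27 ∧ kerM 2 1 = 18 ∧ kerM 2 2 = 19 ∧ kerM 2 3 = 21 ∧
    kerM 3 0 = 21 ∧ kerM 3 1 = 27 ∧ kerM 3 2 = 18 ∧ kerM 3 3 = 19 := by decide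

/-- Parikh vector at a position with the block decomposition. -/
theorem kerP_decomp (q r : ℕ) (hr : r < 85) :
    kerP 0 (85 * q + r) = 19 * kerP 0 q + 18 * kerP 1 q + 27 * kerP 2 q + 21 * kerP 3 q
      + kerV (kerW q) r 0 ∧
    kerP 1 (85 * q + r) = 21 * kerP 0 q + 19 * kerP 1 q + 18 * kerP 2 q + 27 * kerP 3 q
      + kerV (kerW q) r 1 ∧
    kerP 2 (85 * q + r) = 27 * kerP 0 q + 21 * kerP 1 q + 19 * kerP 2 q + 18 * kerP 3 q
      + kerV (kerW q) r 2 ∧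
    kerP 3 (85 * q + r) = 18 * kerP 0 q + 27 * kerP 1 q + 21 * kerP 2 q + 19 * kerP 3 q
      + kerV (kerW q) r 3 := by
  obtain ⟨m1, m2, m3, m4, m5, m6, m7, m8, m9, m10, m11, m12, m13, m14, m15, m16⟩ := kerM_vals
  refine ⟨?_, ?_, ?_, ?_⟩ <;> rw [kerP_block _ _ _ hr.le, kerP_mul _ _ (by omega)] <;>
    simp only [*] <;> ring

/-- Shifted version: passing to the next index adds one column of the matrix. -/
theorem kerP_shift (q d : ℕ) (hd : d ≤ 1) :
    19 * kerP 0 (q + d) + 18 * kerP 1 (q + d) + 27 * kerP 2 (q + d) + 21 * kerP 3 (q + d) =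
      19 * kerP 0 q + 18 * kerP 1 q + 27 * kerP 2 q + 21 * kerP 3 q + d * kerM (kerW q) 0 ∧
    21 * kerP 0 (q + d) + 19 * kerP 1 (q + d) + 18 * kerP 2 (q + d) + 27 * kerP 3 (q + d) =
      21 * kerP 0 q + 19 * kerP 1 q + 18 * kerP 2 q + 27 * kerP 3 q + d * kerM (kerW q) 1 ∧
    27 * kerP 0 (q + d) + 21 * kerP 1 (q + d) + 19 * kerP 2 (q + d) + 18 * kerP 3 (q + d) =
      27 * kerP 0 q + 21 * kerP 1 q + 19 * kerP 2 q + 18 * kerP 3 q + d * kerM (kerW q) 2 ∧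
    18 * kerP 0 (q + d) + 27 * kerP 1 (q + d) + 21 * kerP 2 (q + d) + 19 * kerP 3 (q + d) =
      18 * kerP 0 q + 27 * kerP 1 q + 21 * kerP 2 q + 19 * kerP 3 q + d * kerM (kerW q) 3 := by
  obtain ⟨m1, m2, m3, m4, m5, m6, m7, m8, m9, m10, m11, m12, m13, m14, m15, m16⟩ := kerM_vals
  have hw := kerW_lt q
  interval_cases d
  · simp
  · simp only [kerP_succ]
    generalize kerW q = a at *
    interval_cases a <;> simp [*] <;> omega

set_option maxHeartbeats 2000000 in
theorem kerP_descend {q₀ q₁ q₂ r₀ r₁ r₂ d₀ d₁ d₂ : ℕ} (hr₀ : r₀ < 85) (hr₁ : r₁ < 85)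
    (hr₂ : r₂ < 85) (hd₀ : d₀ ≤ 1) (hd₁ : d₁ ≤ 1) (hd₂ : d₂ ≤ 1)
    (h : ∀ b < 4, kerP b (85 * q₀ + r₀) + kerP b (85 * q₂ + r₂) = 2 * kerP b (85 * q₁ + r₁))
    (he : kerEq d₀ d₁ d₂ (kerMk (kerW q₀) r₀) (kerMk (kerW q₁) r₁) (kerMk (kerW q₂) r₂)) :
    ∀ b < 4, kerP b (q₀ + d₀) + kerP b (q₂ + d₂) = 2 * kerP b (q₁ + d₁) := by
  have h0 := h 0 (by omega)
  have h1 := h 1 (by omega)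
  have h2 := h 2 (by omega)
  have h3 := h 3 (by omega)
  obtain ⟨a0, a1, a2, a3⟩ := kerP_decomp q₀ r₀ hr₀
  obtain ⟨b0, b1, b2, b3⟩ := kerP_decomp q₁ r₁ hr₁
  obtain ⟨c0, c1, c2, c3⟩ := kerP_decomp q₂ r₂ hr₂
  obtain ⟨s0, s1, s2, s3⟩ := kerP_shift q₀ d₀ hd₀
  obtain ⟨t0, t1, t2, t3⟩ := kerP_shift q₁ d₁ hd₁
  obtain ⟨u0, u1, u2, u3⟩ := kerP_shift q₂ d₂ hd₂
  obtain ⟨e0, e1, e2, e3⟩ := he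
  simp only [kerMk, mul_assoc] at e0 e1 e2 e3
  have key := kerM_inj
    ((kerP 0 (q₀ + d₀) : ℤ) + kerP 0 (q₂ + d₂) - 2 * kerP 0 (q₁ + d₁))
    ((kerP 1 (q₀ + d₀) : ℤ) + kerP 1 (q₂ + d₂) - 2 * kerP 1 (q₁ + d₁))
    ((kerP 2 (q₀ + d₀) : ℤ) + kerP 2 (q₂ + d₂) - 2 * kerP 2 (q₁ + d₁))
    ((kerP 3 (q₀ + d₀) : ℤ) + kerP 3 (q₂ + d₂) - 2 * kerP 3 (q₁ + d₁))
    (by zify at h0 a0 b0 c0 s0 t0 u0 e0; linarith) (by zify at h1 a1 b1 c1 s1 t1 u1 e1; linarith)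
    (by zify at h2 a2 b2 c2 s2 t2 u2 e2; linarith) (by zify at h3 a3 b3 c3 s3 t3 u3 e3; linarith)
  obtain ⟨z0, z1, z2, z3⟩ := key
  clear * - z0 z1 z2 z3
  intro b hb
  interval_cases b <;> omega

/-- No abelian squares in the word of Keränen. -/
theorem kerW_free (k : ℕ) : ∀ i j : ℕ, i < j → j < k →
    (∀ b < 4, kerP b i + kerP b k = 2 * kerP b j) → False := by
  induction k using Nat.strong_induction_on with
  | _ k ih =>
    intro i j hij hjk h
    have hs : i + k = 2 * j := by
      have := kerP_sum i
      have := kerP_sum j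
      have := kerP_sum k
      have := h 0 (by omega)
      have := h 1 (by omega)
      have := h 2 (by omega)
      have := h 3 (by omega)
      omega
    obtain ⟨q₀, r₀, hr₀, rfl⟩ : ∃ q r, r < 85 ∧ i = 85 * q + r :=
      ⟨i / 85, i % 85, by omega, by omega⟩
    obtain ⟨q₁, r₁, hr₁, rfl⟩ : ∃ q r, r < 85 ∧ j = 85 * q + r :=
      ⟨j / 85, j % 85, by omega, by omega⟩
    obtain ⟨q₂, r₂, hr₂, rfl⟩ : ∃ q r, r < 85 ∧ k = 85 * q + r :=
      ⟨k / 85, k % 85, by omega, by omega⟩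
    have h0 := h 0 (by omega)
    have h1 := h 1 (by omega)
    have h2 := h 2 (by omega)
    have h3 := h 3 (by omega)
    obtain ⟨a0, a1, a2, a3⟩ := kerP_decomp q₀ r₀ hr₀
    obtain ⟨b0, b1, b2, b3⟩ := kerP_decomp q₁ r₁ hr₁
    obtain ⟨c0, c1, c2, c3⟩ := kerP_decomp q₂ r₂ hr₂
    have hgood : kerGood (kerMk (kerW q₀) r₀) (kerMk (kerW q₁) r₁) (kerMk (kerW q₂) r₂) := by
      apply kerChk_sound (kerW_lt _) (kerW_lt _) (kerW_lt _) hr₀ hr₁ hr₂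
      · omega
      · simp only [kerMk]
        omega
    obtain ⟨hsh, hA, hB, hC⟩ := hgood
    simp only [kerDegA, kerDegB, kerDegC, kerMk] at hA hB hC
    have hfin : ∀ d₀ d₁ d₂ : ℕ, d₀ ≤ 1 → d₁ ≤ 1 → d₂ ≤ 1 →
        kerEq d₀ d₁ d₂ (kerMk (kerW q₀) r₀) (kerMk (kerW q₁) r₁) (kerMk (kerW q₂) r₂) → False := by
      intro d₀ d₁ d₂ hd₀ hd₁ hd₂ he
      have hd := kerP_descend hr₀ hr₁ hr₂ hd₀ hd₁ hd₂ h he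
      have hs' : (q₀ + d₀) + (q₂ + d₂) = 2 * (q₁ + d₁) := by
        have := kerP_sum (q₀ + d₀)
        have := kerP_sum (q₁ + d₁)
        have := kerP_sum (q₂ + d₂)
        have := hd 0 (by omega)
        have := hd 1 (by omega)
        have := hd 2 (by omega)
        have := hd 3 (by omega)
        omega
      by_cases hlt : q₀ + d₀ < q₁ + d₁
      · exact ih (q₂ + d₂) (by omega) (q₀ + d₀) (q₁ + d₁) hlt (by omega) hd
      · have hcase : (q₀ = q₁ ∧ q₂ = q₁) ∨ (q₀ = q₁ ∧ q₂ = q₁ + 1) ∨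
            (q₁ = q₀ + 1 ∧ q₂ = q₀ + 1) := by omega
        rcases hcase with ⟨rfl, rfl⟩ | ⟨rfl, rfl⟩ | ⟨rfl, rfl⟩
        · exact hA rfl rfl (by omega) ⟨by omega, by omega, by omega, by omega⟩
        · obtain ⟨s0, s1, s2, s3⟩ := kerP_shift q₀ 1 le_rfl
          exact hB rfl (kerW_succ_ne _) (by omega) ⟨by omega, by omega, by omega, by omega⟩
        · obtain ⟨s0, s1, s2, s3⟩ := kerP_shift q₀ 1 le_rfl
          exact hC (kerW_succ_ne _) rfl (by omega) ⟨by omega, by omega, by omega, by omega⟩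
    rcases hsh with he | he | he | he | he | he
    all_goals exact hfin _ _ _ (by omega) (by omega) (by omega) he

theorem kerW_count (s l b : ℕ) :
    kerP b (s + l) = kerP b s + ((List.range' s l).map kerW).count b := by
  induction l with
  | zero => simp
  | succ l ih =>
    rw [← add_assoc, kerP_succ, ih, List.range'_concat]
    simp [List.count_singleton, add_assoc]

theorem kerW_not_anagram (s l : ℕ) : ¬ IsAnagram ((List.range' s l).map kerW) := by
  rintro ⟨w₁, w₂, hne, hp, he⟩
  have hl : l = w₁.length + w₁.length := by
    have := congrArg List.length he
    simpa [← hp.length_eq] using this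
  have hpos : 0 < w₁.length := List.length_pos_iff.2 hne
  generalize hm : w₁.length = m at *
  subst hl
  rw [← List.range'_append_1, List.map_append] at he
  obtain ⟨e1, e2⟩ := List.append_inj he (by simp [hm])
  refine kerW_free (s + m + m) s (s + m) (by omega) (by omega) ?_
  intro b _
  have c1 := kerW_count s m b
  have c2 := kerW_count (s + m) m b
  rw [e1] at c1
  rw [e2, ← hp.count_eq] at c2
  omega

theorem isAnagram_reverse {α : Type*} {l : List α} (h : IsAnagram l) : IsAnagram l.reverse := by
  obtain ⟨w₁, w₂, hne, hp, rfl⟩ := h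
  refine ⟨w₂.reverse, w₁.reverse, ?_, ?_, by simp⟩
  · intro h
    rw [List.reverse_eq_nil_iff] at h
    subst h
    exact hne hp.eq_nil
  · exact (List.reverse_perm _).trans (hp.symm.trans (List.reverse_perm _).symm)

theorem isAnagram_map {α β : Type*} (f : α → β) {l : List α} (h : IsAnagram l) :
    IsAnagram (l.map f) := by
  obtain ⟨w₁, w₂, hne, hp, rfl⟩ := h
  exact ⟨w₁.map f, w₂.map f, by simpa using hne, hp.map f, by simp⟩

theorem chain_up (t : List ℕ) : ∀ a b : ℕ, b = a + 1 → (a :: b :: t).Nodup →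
    (a :: b :: t).IsChain (fun x y => x + 1 = y ∨ y + 1 = x) →
    a :: b :: t = List.range' a (t.length + 2) := by
  induction t with
  | nil => intro a b h _ _; subst h; rfl
  | cons c t ih =>
    intro a b h hn hc
    have hc' := (List.isChain_cons_cons.1 hc).2
    have hbc := (List.isChain_cons_cons.1 hc').1
    have hac : a ≠ c := by
      rintro rfl
      simp at hn
    have := ih b c (by omega) (List.nodup_cons.1 hn).2 hc'
    rw [this, h]
    rfl

theorem chain_down (t : List ℕ) : ∀ a b : ℕ, a = b + 1 → (a :: b :: t).Nodup →
    (a :: b :: t).IsChain (fun x y => x + 1 = y ∨ y + 1 = x) →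
    ∃ s, s + (t.length + 2) = a + 1 ∧ (a :: b :: t).reverse = List.range' s (t.length + 2) := by
  induction t with
  | nil => intro a b h _ _; subst h; exact ⟨b, rfl, rfl⟩
  | cons c t ih =>
    intro a b h hn hc
    have hc' := (List.isChain_cons_cons.1 hc).2
    have hbc := (List.isChain_cons_cons.1 hc').1
    have hac : a ≠ c := by
      rintro rfl
      simp at hn
    obtain ⟨s, hs, he⟩ := ih b c (by omega) (List.nodup_cons.1 hn).2 hc'
    refine ⟨s, by simp; omega, ?_⟩
    rw [List.reverse_cons, he, List.length_cons, List.range'_concat (n := t.length + 2)]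
    congr 2
    omega

theorem chain_not_anagram (l : List ℕ) (hn : l.Nodup)
    (hc : l.IsChain (fun x y => x + 1 = y ∨ y + 1 = x)) : ¬ IsAnagram (l.map kerW) := by
  match l, hn, hc with
  | [], _, _ => exact kerW_not_anagram 0 0
  | [a], _, _ => exact kerW_not_anagram a 1
  | a :: b :: t, hn, hc =>
    rcases (List.isChain_cons_cons.1 hc).1 with h | h
    · rw [chain_up t a b h.symm hn hc]
      exact kerW_not_anagram _ _
    · obtain ⟨s, _, he⟩ := chain_down t a b h.symm hn hc
      intro ha
      have := isAnagram_reverse ha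
      rw [← List.map_reverse, he] at this
      exact kerW_not_anagram _ _ this

theorem anagram_count_ne_one {α : Type*} [DecidableEq α] {l : List α} (h : IsAnagram l) (x : α) :
    l.count x ≠ 1 := by
  obtain ⟨w₁, w₂, _, hp, rfl⟩ := h
  rw [List.count_append, hp.count_eq]
  omega
/-- Every cycle has an anagram-free vertex colouring with at
most `5` colours: `φ(C) ≤ 5`. -/
theorem cycle_anagramFree_chromatic_le_five (n : ℕ) (hn : 3 ≤ n) :
    ∃ f : Fin n → Fin 5, AnagramFreeVC (SimpleGraph.cycleGraph n) f := by
  obtain ⟨m, rfl⟩ : ∃ m, n = m + 2 := ⟨n - 2, by omega⟩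
  refine ⟨fun v => if v.val = m + 1 then 4 else ⟨kerW v.val, by have := kerW_lt v.val; omega⟩, ?_⟩
  intro u v p hp ha
  have hnd : p.support.Nodup := hp.support_nodup
  by_cases hmem : Fin.last (m + 1) ∈ p.support
  · apply anagram_count_ne_one ha 4
    rw [List.count, List.countP_map]
    refine Eq.trans ?_ (List.count_eq_one_of_mem hnd hmem)
    rw [List.count]
    apply List.countP_congr
    intro x _
    have := kerW_lt x.val
    by_cases hx : x.val = m + 1
    · have : x = Fin.last (m + 1) := Fin.ext hx
      subst this
      simp
    · have h4 : kerW x.val ≠ 4 := by omega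
      have hx' : x ≠ Fin.last (m + 1) := fun h => hx (by rw [h]; rfl)
      have h5 : (⟨kerW x.val, by omega⟩ : Fin 5) ≠ 4 := fun h => h4 (congrArg Fin.val h)
      simp [hx, hx', h5]
  · have hlt : ∀ x ∈ p.support, x.val ≠ m + 1 := by
      intro x hx h
      apply hmem
      have : x = Fin.last (m + 1) := Fin.ext h
      rwa [← this]
    have ha' := isAnagram_map Fin.val ha
    have heq : (p.support.map (fun v : Fin (m + 2) => if v.val = m + 1 then (4 : Fin 5) else
        ⟨kerW v.val, by have := kerW_lt v.val; omega⟩)).map Fin.val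
        = (p.support.map Fin.val).map kerW := by
      rw [List.map_map, List.map_map]
      apply List.map_congr_left
      intro x hx
      simp [hlt x hx]
    rw [heq] at ha'
    refine chain_not_anagram _ (hnd.map Fin.val_injective) ?_ ha'
    rw [List.isChain_map]
    have hch := p.isChain_adj_support
    refine List.IsChain.imp_of_mem_imp ?_ hch
    intro x y hx hy hxy
    have h1 := hlt x hx
    have h2 := hlt y hy
    rw [SimpleGraph.cycleGraph_adj] at hxy
    have hx' := x.isLt
    have hy' := y.isLt
    rcases hxy with h | h
    · have e : x = y + 1 := by rw [← h]; abel
      right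
      rw [e, Fin.val_add_one_of_lt (by rw [Fin.lt_def, Fin.val_last]; omega)]
    · have e : y = x + 1 := by rw [← h]; abel
      left
      rw [e, Fin.val_add_one_of_lt (by rw [Fin.lt_def, Fin.val_last]; omega)]
end
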